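/- Let n ≤ 6 and let u ∈ C²(closure(B₁)) with 0 ≤ u < 1 be a stable solution of −Δu = f(u) in the unit ball B₁ ⊂ ℝⁿ, where f ∈ C²([0,1)) satisfies f ≥ 0, f′ ≥ 0, F(1) = +∞, and there exist θ > 0 and K ≥ 0 such that f″(t)f(t) ≥ (1+θ)f′(t)² − K for all 0 ≤ t < 1. Then there is a constant C, depending only on n, θ, and K, such that F(u(x)) ≤ C‖u‖²_{L¹(B₁)} for every x ∈ B_{1/2} (equivalently, ‖u‖_{L∞(B_{1/2})} ≤ F⁻¹(C‖u‖²_{L¹(B₁)}) < 1). -/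

import Mathlib

open MeasureTheory Set Filter Topology Bornology Metric

/-- The Laplacian of `u : ℝⁿ → ℝ`, as the sum of second partial derivatives. -/
noncomputable def lap {n : ℕ} (u : EuclideanSpace ℝ (Fin n) → ℝ)
    (x : EuclideanSpace ℝ (Fin n)) : ℝ :=
  ∑ i, fderiv ℝ (fun y => fderiv ℝ u y (EuclideanSpace.single i 1)) x (EuclideanSpace.single i 1)

/-- `f` is of class `C²([0,1))`, with first and second derivatives `f'`, `f''`. -/
def C2On01 (f f' f'' : ℝ → ℝ) : Prop :=
  (∀ t ∈ Ico (0:ℝ) 1, HasDerivWithinAt f (f' t) (Ico (0:ℝ) 1) t) ∧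
  (∀ t ∈ Ico (0:ℝ) 1, HasDerivWithinAt f' (f'' t) (Ico (0:ℝ) 1) t) ∧
  ContinuousOn f'' (Ico (0:ℝ) 1)

/-- Stability of a solution `u` of `-Δu = f(u)` in `Ω`: nonnegativity of the second variation of
the energy on all smooth test functions compactly supported in `Ω`. Here `f'` is the derivative
of the nonlinearity. -/
def StableSol {n : ℕ} (f' : ℝ → ℝ) (u : EuclideanSpace ℝ (Fin n) → ℝ)
    (Ω : Set (EuclideanSpace ℝ (Fin n))) : Prop :=
  ∀ ξ : EuclideanSpace ℝ (Fin n) → ℝ, ContDiff ℝ (⊤:ℕ∞) ξ → HasCompactSupport ξ →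
    tsupport ξ ⊆ Ω →
    0 ≤ ∫ x in Ω, (‖gradient ξ x‖ ^ 2 - f' (u x) * ξ x ^ 2)

/-- The Euclidean space `ℝⁿ`. -/
abbrev Euc (n : ℕ) := EuclideanSpace ℝ (Fin n)

/-- The `i`-th vector of the standard basis of `ℝⁿ`. -/
noncomputable abbrev stdVec {n : ℕ} (i : Fin n) : Euc n := EuclideanSpace.single i (1 : ℝ)

/-- `a` is of class `C¹` on `U` with Fréchet derivative `a'`. -/
def HasC1On {n : ℕ} (U : Set (Euc n)) (a : Euc n → ℝ) (a' : Euc n → Euc n →L[ℝ] ℝ) : Prop :=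
  (∀ x ∈ U, HasFDerivAt a (a' x) x) ∧ ContinuousOn a' U

/-- `b` is of class `C²` on `U` with Fréchet derivative `b'`, and `b'' i` is the derivative of the
`i`-th partial derivative. -/
def HasC2On {n : ℕ} (U : Set (Euc n)) (b : Euc n → ℝ) (b' : Euc n → Euc n →L[ℝ] ℝ)
    (b'' : Fin n → Euc n → Euc n →L[ℝ] ℝ) : Prop :=
  HasC1On U b b' ∧ ∀ i, HasC1On U (fun x => b' x (stdVec i)) (b'' i)

section Calculus

variable {n : ℕ} {U V : Set (Euc n)} {a b : Euc n → ℝ} {a' b' : Euc n → Euc n →L[ℝ] ℝ}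
  {b'' : Fin n → Euc n → Euc n →L[ℝ] ℝ}

lemma HasC1On.continuousOn (h : HasC1On U a a') : ContinuousOn a U :=
  fun x hx => (h.1 x hx).continuousAt.continuousWithinAt

lemma HasC1On.continuousOn_apply (h : HasC1On U a a') (v : Euc n) :
    ContinuousOn (fun x => a' x v) U :=
  h.2.clm_apply continuousOn_const

lemma HasC1On.mul (ha : HasC1On U a a') (hb : HasC1On U b b') :
    HasC1On U (fun x => a x * b x) (fun x => a x • b' x + b x • a' x) :=
  ⟨fun x hx => (ha.1 x hx).mul (hb.1 x hx),
    (ha.continuousOn.smul hb.2).add (hb.continuousOn.smul ha.2)⟩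

lemma HasC1On.const_mul (c : ℝ) (ha : HasC1On U a a') :
    HasC1On U (fun x => c * a x) (fun x => c • a' x) :=
  ⟨fun x hx => (ha.1 x hx).const_mul c, ha.2.const_smul c⟩

lemma HasC1On.comp_real {s : Set ℝ} {g g' : ℝ → ℝ} (hU : IsOpen U)
    (hg : ∀ t ∈ s, HasDerivWithinAt g (g' t) s t) (hg' : ContinuousOn g' s)
    (ha : HasC1On U a a') (hs : ∀ x ∈ U, a x ∈ s) :
    HasC1On U (fun x => g (a x)) (fun x => g' (a x) • a' x) := by
  refine ⟨fun x hx => ?_, (hg'.comp ha.continuousOn hs).smul ha.2⟩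
  exact (hg _ (hs x hx)).comp_hasFDerivAt x (ha.1 x hx)
    (Filter.mem_of_superset (hU.mem_nhds hx) hs)

/-- Affine change of variables. -/
lemma HasC1On.comp_affine (ha : HasC1On U a a') (x₀ : Euc n) (r : ℝ)
    (hV : ∀ z ∈ V, x₀ + r • z ∈ U) :
    HasC1On V (fun z => a (x₀ + r • z)) (fun z => r • a' (x₀ + r • z)) := by
  refine ⟨fun z hz => ?_, ?_⟩
  · have h1 : HasFDerivAt (fun z : Euc n => x₀ + r • z) (r • ContinuousLinearMap.id ℝ (Euc n)) z :=
      ((hasFDerivAt_id z).const_smul r).const_add x₀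
    have h2 := (ha.1 _ (hV z hz)).comp z h1
    have h3 : a' (x₀ + r • z) ∘L (r • ContinuousLinearMap.id ℝ (Euc n)) = r • a' (x₀ + r • z) := by
      ext v; simp
    rw [h3] at h2
    exact h2
  · exact (ha.2.comp (by fun_prop) hV).const_smul r

lemma HasC2On.comp_affine (hb : HasC2On U b b' b'') (x₀ : Euc n) (r : ℝ)
    (hV : ∀ z ∈ V, x₀ + r • z ∈ U) :
    HasC2On V (fun z => b (x₀ + r • z)) (fun z => r • b' (x₀ + r • z))
      (fun i z => r • r • b'' i (x₀ + r • z)) :=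
  ⟨hb.1.comp_affine x₀ r hV, fun i => ((hb.2 i).comp_affine x₀ r hV).const_mul r⟩

/-- A `C²` real function of a `C²` function is `C²`. -/
lemma HasC2On.comp_real {s : Set ℝ} {g g' g'' : ℝ → ℝ} (hU : IsOpen U)
    (hg : ∀ t ∈ s, HasDerivWithinAt g (g' t) s t) (hg' : ∀ t ∈ s, HasDerivWithinAt g' (g'' t) s t)
    (hg'' : ContinuousOn g'' s) (hb : HasC2On U b b' b'') (hs : ∀ x ∈ U, b x ∈ s) :
    HasC2On U (fun x => g (b x)) (fun x => g' (b x) • b' x)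
      (fun i x => g' (b x) • b'' i x + b' x (stdVec i) • (g'' (b x) • b' x)) :=
  ⟨hb.1.comp_real hU hg (fun t ht => (hg' t ht).continuousWithinAt) hs,
    fun i => (hb.1.comp_real hU hg' hg'' hs).mul (hb.2 i)⟩

lemma ContDiffOn.hasC2On (hU : IsOpen U) (h : ContDiffOn ℝ 2 b U) :
    HasC2On U b (fderiv ℝ b) (fun i => fderiv ℝ (fun y => fderiv ℝ b y (stdVec i))) := by
  have h1 : ContDiffOn ℝ 1 (fderiv ℝ b) U := h.fderiv_of_isOpen hU (by norm_num)
  refine ⟨⟨fun x hx => ((h.contDiffAt (hU.mem_nhds hx)).differentiableAt (by norm_num)).hasFDerivAt,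
    h1.continuousOn⟩, fun i => ?_⟩
  have h2 : ContDiffOn ℝ 1 (fun y => fderiv ℝ b y (stdVec i)) U := h1.clm_apply contDiffOn_const
  exact ⟨fun x hx =>
    ((h2.contDiffAt (hU.mem_nhds hx)).differentiableAt (by norm_num)).hasFDerivAt,
    (h2.fderiv_of_isOpen hU (by norm_num : (0 : WithTop ℕ∞) + 1 ≤ 1)).continuousOn⟩

lemma continuous_of_vanish {F : Type*} [TopologicalSpace F] [Zero F] {Kc : Set (Euc n)}
    {h : Euc n → F} (hU : IsOpen U)
    (hK : IsClosed Kc) (hKU : Kc ⊆ U) (hc : ContinuousOn h U) (h0 : ∀ x ∉ Kc, h x = 0) :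
    Continuous h := by
  rw [continuous_iff_continuousAt]
  intro x
  by_cases hx : x ∈ U
  · exact hc.continuousAt (hU.mem_nhds hx)
  · have hx' : x ∈ Kcᶜ := fun h => hx (hKU h)
    have : h =ᶠ[𝓝 x] fun _ => 0 :=
      Filter.mem_of_superset (hK.isOpen_compl.mem_nhds hx') (fun y hy => h0 y hy)
    exact continuousAt_const.congr this.symm

lemma integrable_of_vanish {Kc : Set (Euc n)} {h : Euc n → ℝ} (hU : IsOpen U)
    (hK : IsCompact Kc) (hKU : Kc ⊆ U) (hc : ContinuousOn h U) (h0 : ∀ x ∉ Kc, h x = 0) :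
    Integrable h :=
  (continuous_of_vanish hU hK.isClosed hKU hc h0).integrable_of_hasCompactSupport
    (HasCompactSupport.intro hK h0)

lemma setIntegral_of_vanish {Kc : Set (Euc n)} {h : Euc n → ℝ} (hKU : Kc ⊆ U)
    (h0 : ∀ x ∉ Kc, h x = 0) : ∫ x in U, h x = ∫ x, h x :=
  setIntegral_eq_integral_of_forall_compl_eq_zero fun x hx => h0 x fun h => hx (hKU h)

lemma HasC1On.integral_apply_eq_zero {Kc : Set (Euc n)} (hU : IsOpen U) (hK : IsCompact Kc)
    (hKU : Kc ⊆ U) (ha : HasC1On U a a') (h0 : ∀ x ∉ Kc, a x = 0) (v : Euc n) :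
    ∫ x in U, a' x v = 0 := by
  classical
  set D : Euc n → Euc n →L[ℝ] ℝ := fun x => fderiv ℝ a x with hD
  have hDU : ∀ x ∈ U, D x = a' x := fun x hx => (ha.1 x hx).fderiv
  have hev : ∀ x ∉ Kc, a =ᶠ[𝓝 x] fun _ => 0 := fun x hx =>
    Filter.mem_of_superset (hK.isClosed.isOpen_compl.mem_nhds hx) (fun y hy => h0 y hy)
  have hD0 : ∀ x ∉ Kc, D x = 0 := fun x hx => by
    rw [hD]; simp only [(hev x hx).fderiv_eq]; simp
  have hDc : ContinuousOn D U := ha.2.congr hDU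
  have hdiff : ∀ x, DifferentiableAt ℝ a x := fun x => by
    by_cases hx : x ∈ Kc
    · exact (ha.1 x (hKU hx)).differentiableAt
    · exact (hev x hx).differentiableAt_iff.2 (differentiableAt_const _)
  have hDv0 : ∀ x ∉ Kc, D x v = 0 := fun x hx => by rw [hD0 x hx]; simp
  have key := integral_mul_fderiv_eq_neg_fderiv_mul_of_integrable (μ := volume)
    (f := fun _ : Euc n => (1 : ℝ)) (g := a) (v := v) (by simp)
    (by simpa using integrable_of_vanish hU hK hKU (hDc.clm_apply continuousOn_const) hDv0)
    (by simpa using integrable_of_vanish hU hK hKU ha.continuousOn h0)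
    (fun x _ => differentiableAt_const _) (fun x _ => hdiff x)
  rw [setIntegral_congr_fun hU.measurableSet
    (fun x hx => by simp only [hDU x hx] : EqOn (fun x => a' x v) (fun x => D x v) U),
    setIntegral_of_vanish hKU hDv0]
  simpa using key

/-- Green's identity without boundary terms. -/
lemma integral_green {Kc : Set (Euc n)} (hU : IsOpen U) (hK : IsCompact Kc)
    (hKU : Kc ⊆ U) (ha : HasC1On U a a') (hb : HasC2On U b b' b'')
    (h0 : ∀ x ∉ Kc, a x = 0 ∨ ∀ i, b' x (stdVec i) = 0) :
    IntegrableOn (fun x => ∑ i, (a' x (stdVec i) * b' x (stdVec i) +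
      a x * b'' i x (stdVec i))) U ∧
    ∫ x in U, ∑ i, (a' x (stdVec i) * b' x (stdVec i) + a x * b'' i x (stdVec i)) = 0 := by
  have hc : ∀ i : Fin n, HasC1On U (fun x => a x * b' x (stdVec i)) _ := fun i => ha.mul (hb.2 i)
  have hz : ∀ i : Fin n, ∀ x ∉ Kc, a x * b' x (stdVec i) = 0 := fun i x hx => by
    rcases h0 x hx with h | h
    · simp [h]
    · simp [h i]
  have hI : ∀ i : Fin n, IntegrableOn (fun x => a' x (stdVec i) * b' x (stdVec i) +
      a x * b'' i x (stdVec i)) U := fun i => by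
    have hv : ∀ x ∈ U, x ∉ Kc → a' x (stdVec i) * b' x (stdVec i) +
      a x * b'' i x (stdVec i) = 0 := fun x hx hxK => by
      have h1 := (hc i).1 x hx
      have : (fun x => a x * b' x (stdVec i)) =ᶠ[𝓝 x] fun _ => 0 :=
        Filter.mem_of_superset (hK.isClosed.isOpen_compl.mem_nhds hxK) (fun y hy => hz i y hy)
      have h2 := h1.unique ((hasFDerivAt_const (0 : ℝ) x).congr_of_eventuallyEq this)
      have h3 := congrArg (fun L : Euc n →L[ℝ] ℝ => L (stdVec i)) h2
      simp only [add_apply, smul_apply, zero_apply,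
        smul_eq_mul] at h3
      linarith
    have hcont : ContinuousOn (fun x => a' x (stdVec i) * b' x (stdVec i) +
      a x * b'' i x (stdVec i)) U :=
      ((ha.continuousOn_apply _).mul (hb.1.continuousOn_apply _)).add
        (ha.continuousOn.mul ((hb.2 i).continuousOn_apply _))
    have hKi := (hcont.mono hKU).integrableOn_compact hK (μ := volume)
    refine hKi.of_forall_sdiff_eq_zero hU.measurableSet fun x hx => hv x hx.1 hx.2
  refine ⟨integrable_finsetSum _ fun i _ => hI i, ?_⟩
  rw [integral_finsetSum _ fun i _ => hI i]
  refine Finset.sum_eq_zero fun i _ => ?_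
  rw [← (hc i).integral_apply_eq_zero hU hK hKU (hz i) (stdVec i)]
  refine setIntegral_congr_fun hU.measurableSet fun x _ => ?_
  simp only [add_apply, smul_apply, smul_eq_mul]
  ring

end Calculus

section Bump

lemma hasDerivAt_max_zero_pow (k : ℕ) (t : ℝ) :
    HasDerivAt (fun t : ℝ => max 0 t ^ (k + 2)) ((k + 2) * max 0 t ^ (k + 1)) t := by
  have hpow : HasDerivAt (fun t : ℝ => t ^ (k + 2)) ((k + 2) * t ^ (k + 1)) t := by
    simpa using hasDerivAt_pow (k + 2) t
  rcases lt_trichotomy t 0 with ht | rfl | ht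
  · have : (fun t : ℝ => max 0 t ^ (k + 2)) =ᶠ[𝓝 t] fun _ => 0 := by
      filter_upwards [Iio_mem_nhds ht] with s hs
      rw [max_eq_left (le_of_lt hs)]; simp
    rw [max_eq_left ht.le]
    simpa using (hasDerivAt_const t (0 : ℝ)).congr_of_eventuallyEq this
  · rw [← hasDerivWithinAt_univ, ← Iic_union_Ici (a := (0 : ℝ))]
    refine HasDerivWithinAt.union ?_ ?_
    · simpa using (hasDerivWithinAt_const (0 : ℝ) (Iic 0) (0 : ℝ)).congr
        (f₁ := fun t : ℝ => max 0 t ^ (k + 2))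
        (fun s hs => by simp [max_eq_left (show s ≤ 0 from hs)]) (by simp)
    · simpa using hpow.hasDerivWithinAt.congr (s := Ici 0) (f₁ := fun t : ℝ => max 0 t ^ (k + 2))
        (fun s hs => by simp only [max_eq_right (show 0 ≤ s from hs)]) (by simp)
  · have : (fun t : ℝ => max 0 t ^ (k + 2)) =ᶠ[𝓝 t] fun t => t ^ (k + 2) := by
      filter_upwards [Ioi_mem_nhds ht] with s hs
      rw [max_eq_right (le_of_lt hs)]
    rw [max_eq_right ht.le]
    exact hpow.congr_of_eventuallyEq this

/-- The `k`-th power of the positive part of `ρ - |x|²`. -/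
noncomputable def bump {n : ℕ} (ρ : ℝ) (k : ℕ) (x : Euc n) : ℝ := max 0 (ρ - ‖x‖ ^ 2) ^ k

variable {n : ℕ} {ρ : ℝ} {k : ℕ}

lemma bump_nonneg (x : Euc n) : 0 ≤ bump ρ k x := pow_nonneg (le_max_left _ _) _

lemma bump_le_one (hρ : ρ ≤ 1) (x : Euc n) : bump ρ k x ≤ 1 :=
  pow_le_one₀ (le_max_left _ _) (max_le zero_le_one (by nlinarith [sq_nonneg ‖x‖]))

lemma continuous_bump : Continuous (bump (n := n) ρ k) := by
  unfold bump; fun_prop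

lemma bump_eq_zero (hk : k ≠ 0) {x : Euc n} (hx : ρ ≤ ‖x‖ ^ 2) : bump ρ k x = 0 := by
  rw [bump, max_eq_left (by linarith), zero_pow hk]

/-- The Fréchet derivative of `bump ρ (k + 2)`. -/
noncomputable def bumpDeriv (ρ : ℝ) (k : ℕ) (x : Euc n) : Euc n →L[ℝ] ℝ :=
  (-(2 * (k + 2)) * bump ρ (k + 1) x) • innerSL ℝ x

lemma bumpDeriv_stdVec (x : Euc n) (i : Fin n) :
    bumpDeriv ρ k x (stdVec i) = -(2 * (k + 2)) * bump ρ (k + 1) x * x i := by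
  have h : inner ℝ x (stdVec i) = x i := by
    rw [EuclideanSpace.inner_single_right]; simp
  simp [bumpDeriv, h]

lemma hasC1On_bump (U : Set (Euc n)) (ρ : ℝ) (k : ℕ) :
    HasC1On U (bump ρ (k + 2)) (bumpDeriv ρ k) := by
  refine ⟨fun x _ => ?_, ?_⟩
  · have h1 : HasFDerivAt (fun x : Euc n => ρ - ‖x‖ ^ 2) (-(2 • innerSL ℝ x)) x :=
      (hasStrictFDerivAt_norm_sq x).hasFDerivAt.const_sub ρ
    have h2 := (hasDerivAt_max_zero_pow k (ρ - ‖x‖ ^ 2)).comp_hasFDerivAt x h1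
    have h3 : ((k + 2 : ℝ) * max 0 (ρ - ‖x‖ ^ 2) ^ (k + 1)) • (-(2 • innerSL ℝ x)) =
        bumpDeriv ρ k x := by
      ext v
      simp [bumpDeriv, bump]
      ring
    rw [h3] at h2
    exact h2
  · unfold bumpDeriv
    exact ((continuous_const.mul continuous_bump).smul (innerSL ℝ).continuous).continuousOn

/-- The derivatives of the partial derivatives of `bump ρ (k + 3)`. -/
noncomputable def bumpDeriv₂ (ρ : ℝ) (k : ℕ) (i : Fin n) (x : Euc n) : Euc n →L[ℝ] ℝ :=
  (-(2 * ((k + 1 : ℕ) + 2)) : ℝ) •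
    (bump ρ (k + 2) x • EuclideanSpace.proj i + x i • bumpDeriv ρ k x)

lemma hasC2On_bump (U : Set (Euc n)) (ρ : ℝ) (k : ℕ) :
    HasC2On U (bump ρ (k + 3)) (bumpDeriv ρ (k + 1)) (bumpDeriv₂ ρ k) := by
  refine ⟨hasC1On_bump U ρ (k + 1), fun i => ?_⟩
  have h1 : HasC1On U (fun x : Euc n => x i) (fun _ => EuclideanSpace.proj i) :=
    ⟨fun x _ => (EuclideanSpace.proj (𝕜 := ℝ) i).hasFDerivAt, continuousOn_const⟩
  have h2 := ((hasC1On_bump U ρ k).mul h1).const_mul (-(2 * ((k + 1 : ℕ) + 2)))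
  have h3 : (fun x : Euc n => -(2 * (((k + 1 : ℕ) : ℝ) + 2)) * (bump ρ (k + 2) x * x i)) =
      fun x => bumpDeriv ρ (k + 1) x (stdVec i) := by
    ext x
    rw [bumpDeriv_stdVec]; ring_nf
  rw [h3] at h2
  exact h2

lemma bumpDeriv₂_stdVec (i : Fin n) (x : Euc n) :
    bumpDeriv₂ ρ k i x (stdVec i) =
      -(2 * (k + 3)) * bump ρ (k + 2) x + 4 * (k + 3) * (k + 2) * bump ρ (k + 1) x * x i ^ 2 := by
  simp only [bumpDeriv₂, smul_apply, add_apply, bumpDeriv_stdVec, smul_eq_mul]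
  simp
  ring

lemma bump_succ (x : Euc n) : bump ρ (k + 1) x = bump ρ k x * bump ρ 1 x := by
  simp [bump, pow_succ]

lemma sum_bumpDeriv₂ (x : Euc n) :
    ∑ i, bumpDeriv₂ ρ k i x (stdVec i) =
      -(2 * (k + 3)) * n * bump ρ (k + 2) x
        + 4 * (k + 3) * (k + 2) * bump ρ (k + 1) x * ‖x‖ ^ 2 := by
  simp only [bumpDeriv₂_stdVec, Finset.sum_add_distrib, ← Finset.mul_sum,
    EuclideanSpace.real_norm_sq_eq]
  simp
  ring

lemma bump_mul_norm_sq_le (hρ : ρ ≤ 1) (hk : k ≠ 0) (x : Euc n) :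
    bump ρ k x * ‖x‖ ^ 2 ≤ bump ρ k x := by
  rcases le_total ρ (‖x‖ ^ 2) with h | h
  · simp [bump_eq_zero hk h]
  · nlinarith [bump_nonneg (ρ := ρ) (k := k) x]

lemma abs_sum_bumpDeriv₂_le (hρ : ρ ≤ 1) (x : Euc n) :
    |∑ i, bumpDeriv₂ ρ k i x (stdVec i)| ≤
      (2 * (k + 3) * n + 4 * (k + 3) * (k + 2)) * bump ρ (k + 1) x := by
  rw [sum_bumpDeriv₂]
  have h0 : 0 ≤ bump ρ (k + 1) x := bump_nonneg x
  have h1 : bump ρ (k + 2) x ≤ bump ρ (k + 1) x := by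
    rw [bump_succ]; exact mul_le_of_le_one_right h0 (bump_le_one hρ x)
  have h2 := bump_mul_norm_sq_le hρ (Nat.succ_ne_zero k) x
  have h3 : 0 ≤ bump ρ (k + 2) x := bump_nonneg x
  have h4 : (0 : ℝ) ≤ 2 * (k + 3) * n := by positivity
  have h5 : (0 : ℝ) ≤ 4 * (k + 3) * (k + 2) := by positivity
  have h6 : 0 ≤ bump ρ (k + 1) x * ‖x‖ ^ 2 := by positivity
  rw [abs_le]
  constructor <;> nlinarith [mul_le_mul_of_nonneg_left h1 h4, mul_le_mul_of_nonneg_left h2 h5,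
    mul_nonneg h4 h3, mul_nonneg h5 h6, mul_nonneg h4 h0, mul_nonneg h5 h0]

end Bump

section MeanValue

variable {n : ℕ} {U : Set (Euc n)} {w : Euc n → ℝ} {w' : Euc n → Euc n →L[ℝ] ℝ}
  {w'' : Fin n → Euc n → Euc n →L[ℝ] ℝ} {g : Euc n → ℝ} {x₀ : Euc n} {d r : ℝ}

lemma sum_coord_mul_apply_stdVec (L : Euc n →L[ℝ] ℝ) (z : Euc n) :
    ∑ i, z i * L (stdVec i) = L z := by
  have h : z = ∑ i, z i • stdVec i := by
    have := (EuclideanSpace.basisFun (Fin n) ℝ).sum_repr z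
    simpa using this.symm
  conv_rhs => rw [h]
  simp [map_sum]

lemma add_smul_mem_closedBall (hr : 0 ≤ r) (hrd : r ≤ d) {z : Euc n} (hz : ‖z‖ ≤ 1) :
    x₀ + r • z ∈ closedBall x₀ d := by
  rw [mem_closedBall, dist_eq_norm, add_sub_cancel_left, norm_smul, Real.norm_of_nonneg hr]
  nlinarith [norm_nonneg z]

lemma integral_ball_comp_affine (h : Euc n → ℝ) (x₀ : Euc n) (hr : 0 < r) :
    ∫ z in ball (0 : Euc n) 1, h (x₀ + r • z) = (r ^ n)⁻¹ * ∫ x in ball x₀ r, h x := by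
  have h1 := Measure.setIntegral_comp_smul_of_pos (volume : Measure (Euc n))
    (fun y => h (x₀ + y)) (ball (0 : Euc n) 1) hr
  rw [h1, smul_unitBall_of_pos hr, finrank_euclideanSpace_fin, smul_eq_mul]
  congr 1
  have h2 := (measurePreserving_add_left (volume : Measure (Euc n)) x₀).setIntegral_preimage_emb
    (measurableEmbedding_addLeft x₀) h (ball x₀ r)
  rw [← h2]
  congr 2
  ext y
  simp [dist_eq_norm]

/-- Green's identity on a small ball, against the weight `(1 - |z|²)₊⁴`. -/
lemma integral_radial_deriv (hU : IsOpen U) (hw : HasC2On U w w' w'') (hr : 0 < r)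
    (hrd : r ≤ d) (hd : closedBall x₀ d ⊆ U) :
    8 * ∫ z in ball (0 : Euc n) 1, w' (x₀ + r • z) z * bump 1 3 z =
      r * ∫ z in ball (0 : Euc n) 1, (∑ i, w'' i (x₀ + r • z) (stdVec i)) * bump 1 4 z := by
  set V : Set (Euc n) := {z | x₀ + r • z ∈ U} with hVdef
  have hV : IsOpen V := hU.preimage (by fun_prop)
  have hKV : closedBall (0 : Euc n) 1 ⊆ V := fun z hz =>
    hd (add_smul_mem_closedBall hr.le hrd (by simpa using hz))
  have hb := hw.comp_affine (V := V) x₀ r (fun z hz => hz)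
  have hz0 : ∀ (k : ℕ), k ≠ 0 → ∀ z : Euc n, z ∉ ball (0 : Euc n) 1 → bump 1 k z = 0 := by
    intro k hk z hz
    refine bump_eq_zero hk ?_
    have : 1 ≤ ‖z‖ := by simpa using hz
    nlinarith
  have hg := (integral_green hV (isCompact_closedBall (0 : Euc n) 1) hKV
    (hasC1On_bump V 1 2) hb (fun z hz => Or.inl (hz0 4 (by norm_num) z
      (fun h => hz (ball_subset_closedBall h))))).2
  have hBV : ball (0 : Euc n) 1 ⊆ V := ball_subset_closedBall.trans hKV
  rw [setIntegral_eq_of_subset_of_forall_sdiff_eq_zero hV.measurableSet hBV] at hg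
  · have hpt : ∀ z, ∑ i, (bumpDeriv 1 2 z (stdVec i) * (r • w' (x₀ + r • z)) (stdVec i) +
        bump 1 (2 + 2) z * (r • r • w'' i (x₀ + r • z)) (stdVec i)) =
        r * (r * ((∑ i, w'' i (x₀ + r • z) (stdVec i)) * bump 1 4 z)
          - 8 * (w' (x₀ + r • z) z * bump 1 3 z)) := by
      intro z
      rw [← sum_coord_mul_apply_stdVec (w' (x₀ + r • z)) z, Finset.sum_mul, Finset.sum_mul,
        Finset.mul_sum, Finset.mul_sum, ← Finset.sum_sub_distrib, Finset.mul_sum]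
      refine Finset.sum_congr rfl fun i _ => ?_
      rw [bumpDeriv_stdVec]
      simp only [smul_apply, smul_eq_mul]
      push_cast
      ring
    simp only [hpt] at hg
    rw [integral_const_mul, integral_sub, integral_const_mul, integral_const_mul] at hg
    · have := (mul_eq_zero.1 hg).resolve_left hr.ne'
      linarith
    · refine Integrable.const_mul ?_ _
      refine IntegrableOn.mono_set (t := closedBall 0 1) ?_ ball_subset_closedBall
      refine ContinuousOn.integrableOn_compact (isCompact_closedBall _ _) ?_
      refine (ContinuousOn.mono ?_ hKV).mul continuous_bump.continuousOn
      exact continuousOn_finsetSum _ fun i _ =>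
        ((hw.2 i).continuousOn_apply (stdVec i)).comp (by fun_prop) (fun z hz => hz)
    · refine Integrable.const_mul ?_ _
      refine IntegrableOn.mono_set (t := closedBall 0 1) ?_ ball_subset_closedBall
      refine ContinuousOn.integrableOn_compact (isCompact_closedBall _ _) ?_
      refine (ContinuousOn.mono ?_ hKV).mul continuous_bump.continuousOn
      have : ContinuousOn (fun z => w' (x₀ + r • z)) V :=
        hw.1.2.comp (by fun_prop) (fun z hz => hz)
      exact this.clm_apply continuousOn_id
  · intro z hz
    refine Finset.sum_eq_zero fun i _ => ?_
    rw [bumpDeriv_stdVec, hz0 _ (by norm_num) z hz.2, hz0 _ (by norm_num) z hz.2]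
    simp

lemma continuousOn_integral_bump (hw : ContinuousOn w U) (hd : closedBall x₀ d ⊆ U) :
    ContinuousOn (fun r => ∫ z in ball (0 : Euc n) 1, w (x₀ + r • z) * bump 1 3 z) (Icc 0 d) := by
  obtain ⟨B, hB⟩ := (isCompact_closedBall x₀ d).exists_bound_of_continuousOn (hw.mono hd)
  have hmaps : ∀ r ∈ Icc 0 d, MapsTo (fun z : Euc n => x₀ + r • z) (ball 0 1)
      (closedBall x₀ d) := fun r hr z hz =>
    add_smul_mem_closedBall hr.1 hr.2 (by simpa using (ball_subset_closedBall hz))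
  refine continuousOn_of_dominated (bound := fun _ => B) (fun r hr => ?_) (fun r hr => ?_)
    (integrableOn_const (by simp [measure_ball_lt_top.ne])) ?_
  · refine ContinuousOn.aestronglyMeasurable ?_ measurableSet_ball
    exact ((hw.mono hd).comp (by fun_prop) (hmaps r hr)).mul continuous_bump.continuousOn
  · refine (ae_restrict_iff' measurableSet_ball).2 (Eventually.of_forall fun z hz => ?_)
    rw [norm_mul, Real.norm_of_nonneg (bump_nonneg z)]
    have h1 := hB _ (hmaps r hr hz)
    have h2 : bump 1 3 z ≤ 1 := bump_le_one le_rfl z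
    nlinarith [norm_nonneg (w (x₀ + r • z)), bump_nonneg (ρ := 1) (k := 3) z]
  · refine (ae_restrict_iff' measurableSet_ball).2 (Eventually.of_forall fun z hz => ?_)
    exact ((hw.mono hd).comp (by fun_prop) (fun r hr => hmaps r hr hz)).mul continuousOn_const

lemma hasDerivAt_integral_bump (hw : HasC1On U w w') (hd : closedBall x₀ d ⊆ U)
    (hr : r ∈ Ioo 0 d) :
    HasDerivAt (fun r => ∫ z in ball (0 : Euc n) 1, w (x₀ + r • z) * bump 1 3 z)
      (∫ z in ball (0 : Euc n) 1, w' (x₀ + r • z) z * bump 1 3 z) r := by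
  obtain ⟨B, hB⟩ := (isCompact_closedBall x₀ d).exists_bound_of_continuousOn (hw.2.mono hd)
  have hmaps : ∀ r ∈ Icc 0 d, MapsTo (fun z : Euc n => x₀ + r • z) (closedBall 0 1)
      (closedBall x₀ d) := fun r hr z hz =>
    add_smul_mem_closedBall hr.1 hr.2 (by simpa using hz)
  have hI : ∀ r ∈ Icc 0 d, IntegrableOn (fun z => w (x₀ + r • z) * bump 1 3 z)
      (ball (0 : Euc n) 1) := fun r hr => by
    refine IntegrableOn.mono_set (t := closedBall 0 1) ?_ ball_subset_closedBall
    refine ContinuousOn.integrableOn_compact (isCompact_closedBall _ _) ?_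
    exact ((hw.continuousOn.mono hd).comp (by fun_prop) (hmaps r hr)).mul
      continuous_bump.continuousOn
  have hnhds : Ioo 0 d ∈ 𝓝 r := Ioo_mem_nhds hr.1 hr.2
  refine (hasDerivAt_integral_of_dominated_loc_of_deriv_le (bound := fun _ => B)
    (F := fun r z => w (x₀ + r • z) * bump 1 3 z)
    (F' := fun r z => w' (x₀ + r • z) z * bump 1 3 z) hnhds ?_ (hI r (Ioo_subset_Icc_self hr))
    ?_ ?_ (integrableOn_const (by simp [measure_ball_lt_top.ne])) ?_).2
  · filter_upwards [hnhds] with s hs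
    exact (hI s (Ioo_subset_Icc_self hs)).aestronglyMeasurable
  · refine ContinuousOn.aestronglyMeasurable ?_ measurableSet_ball
    refine ContinuousOn.mul ?_ continuous_bump.continuousOn
    exact ((hw.2.mono hd).comp (by fun_prop)
      ((hmaps r (Ioo_subset_Icc_self hr)).mono_left ball_subset_closedBall)).clm_apply
      continuousOn_id
  · refine (ae_restrict_iff' measurableSet_ball).2 (Eventually.of_forall fun z hz s hs => ?_)
    have hz1 : ‖z‖ ≤ 1 := by simpa using (ball_subset_closedBall hz)
    rw [norm_mul, Real.norm_of_nonneg (bump_nonneg z)]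
    have h1 := hB _ (hmaps s (Ioo_subset_Icc_self hs) (ball_subset_closedBall hz))
    have h2 : bump 1 3 z ≤ 1 := bump_le_one le_rfl z
    have h3 := (w' (x₀ + s • z)).le_opNorm z
    have h4 := norm_nonneg (w' (x₀ + s • z))
    calc ‖w' (x₀ + s • z) z‖ * bump 1 3 z ≤ ‖w' (x₀ + s • z) z‖ * 1 := by gcongr
      _ ≤ ‖w' (x₀ + s • z)‖ * ‖z‖ := by simpa using h3
      _ ≤ ‖w' (x₀ + s • z)‖ * 1 := by gcongr
      _ ≤ B := by simpa using h1
  · refine (ae_restrict_iff' measurableSet_ball).2 (Eventually.of_forall fun z hz s hs => ?_)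
    have h1 := hw.1 _ (hd (hmaps s (Ioo_subset_Icc_self hs) (ball_subset_closedBall hz)))
    have h2 : HasDerivAt (fun s : ℝ => x₀ + s • z) z s := by
      simpa using ((hasDerivAt_id s).smul_const z).const_add x₀
    exact (h1.comp_hasDerivAt s h2).mul_const _

end MeanValue

section MeanValueBound

variable {n : ℕ} {U : Set (Euc n)} {w : Euc n → ℝ} {w' : Euc n → Euc n →L[ℝ] ℝ}
  {w'' : Fin n → Euc n → Euc n →L[ℝ] ℝ} {g : Euc n → ℝ} {x₀ : Euc n} {d r : ℝ}

lemma le_mul_rpow_add {q y μ : ℝ} (hq : 1 < q) (hy : 0 ≤ y) (hμ : 0 < μ) :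
    y ≤ μ * y ^ q + μ ^ (-1 / (q - 1)) := by
  have hm : 0 ≤ μ ^ (-1 / (q - 1)) := by positivity
  rcases le_total y (μ ^ (-1 / (q - 1))) with h | h
  · have : 0 ≤ μ * y ^ q := by positivity
    linarith
  · have hy0 : 0 < y := lt_of_lt_of_le (by positivity) h
    have h1 : μ⁻¹ ≤ y ^ (q - 1) := by
      calc μ⁻¹ = (μ ^ (-1 / (q - 1))) ^ (q - 1) := by
            rw [← Real.rpow_mul hμ.le, div_mul_cancel₀ _ (by linarith), Real.rpow_neg_one]
        _ ≤ y ^ (q - 1) := Real.rpow_le_rpow (by positivity) h (by linarith)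
    have h2 : y ^ q = y ^ (q - 1) * y := by
      rw [Real.rpow_sub_one hy0.ne', div_mul_cancel₀ _ hy0.ne']
    have h3 : 1 ≤ μ * y ^ (q - 1) := by
      calc 1 = μ * μ⁻¹ := (mul_inv_cancel₀ hμ.ne').symm
        _ ≤ _ := by gcongr
    rw [h2]
    nlinarith

lemma integral_le_of_neg_laplacian_le (hn6 : n ≤ 6) {q μ : ℝ} (hq : 1 < q) (hμ : 0 < μ)
    (hU : IsOpen U) (hw : HasC2On U w w' w'') (hg0 : ∀ x ∈ U, 0 ≤ g x) (hgc : ContinuousOn g U)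
    (hlap : ∀ x ∈ U, -∑ i, w'' i x (stdVec i) ≤ g x) (hd1 : d ≤ 1)
    (hd : closedBall x₀ d ⊆ U) (hr : r ∈ Ioo 0 d) :
    -(r * (μ * ((r ^ 6)⁻¹ * ∫ x in ball x₀ d, g x ^ q) +
      μ ^ (-1 / (q - 1)) * volume.real (ball (0 : Euc n) 1))) / 8 ≤
    ∫ z in ball (0 : Euc n) 1, w' (x₀ + r • z) z * bump 1 3 z := by
  have hr0 : 0 < r := hr.1
  have hmaps : MapsTo (fun z : Euc n => x₀ + r • z) (closedBall 0 1)
      (closedBall x₀ d) := fun z hz =>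
    add_smul_mem_closedBall hr0.le hr.2.le (by simpa using hz)
  have hgd := hgc.mono hd
  have hgq : ContinuousOn (fun x => g x ^ q) (closedBall x₀ d) :=
    hgd.rpow_const fun x _ => Or.inr (by linarith)
  have hInt : ∀ h : Euc n → ℝ, ContinuousOn h (closedBall x₀ d) →
      IntegrableOn (fun z => h (x₀ + r • z)) (ball (0 : Euc n) 1) := fun h hh => by
    refine IntegrableOn.mono_set (t := closedBall 0 1) ?_ ball_subset_closedBall
    exact (hh.comp (by fun_prop) hmaps).integrableOn_compact (isCompact_closedBall _ _)
  have hLc : ContinuousOn (fun x => ∑ i, w'' i x (stdVec i)) (closedBall x₀ d) :=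
    (continuousOn_finsetSum _ fun i _ => (hw.2 i).continuousOn_apply (stdVec i)).mono hd
  have key := integral_radial_deriv hU hw hr0 hr.2.le hd
  have h1 : -∫ z in ball (0 : Euc n) 1, (∑ i, w'' i (x₀ + r • z) (stdVec i)) * bump 1 4 z ≤
      ∫ z in ball (0 : Euc n) 1, (μ * g (x₀ + r • z) ^ q + μ ^ (-1 / (q - 1))) := by
    rw [← integral_neg]
    refine setIntegral_mono_on ?_ ?_ measurableSet_ball fun z hz => ?_
    · refine Integrable.neg (IntegrableOn.mono_set (t := closedBall 0 1) ?_ ball_subset_closedBall)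
      exact ((hLc.comp (by fun_prop) hmaps).mul continuous_bump.continuousOn).integrableOn_compact
        (isCompact_closedBall _ _)
    · exact ((hInt _ hgq).const_mul μ).add (integrableOn_const (by simp [measure_ball_lt_top.ne]))
    · have hx := hd (hmaps (ball_subset_closedBall hz))
      have h2 := hlap _ hx
      have h3 := hg0 _ hx
      have h4 : 0 ≤ bump 1 4 z := bump_nonneg z
      have h5 : bump 1 4 z ≤ 1 := bump_le_one le_rfl z
      have h6 := le_mul_rpow_add hq h3 hμ
      nlinarith
  rw [integral_add ((hInt _ hgq).const_mul μ)
    (integrableOn_const (by simp [measure_ball_lt_top.ne])), integral_const_mul,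
    integral_ball_comp_affine (fun x => g x ^ q) x₀ hr0, setIntegral_const, smul_eq_mul] at h1
  have hG : ∫ x in ball x₀ r, g x ^ q ≤ ∫ x in ball x₀ d, g x ^ q := by
    refine setIntegral_mono_set ?_ ?_ (ball_subset_ball hr.2.le).eventuallyLE
    · exact (hgq.integrableOn_compact (isCompact_closedBall _ _)).mono_set ball_subset_closedBall
    · exact (ae_restrict_iff' measurableSet_ball).2 (Eventually.of_forall fun x hx =>
        Real.rpow_nonneg (hg0 x (hd (ball_subset_closedBall hx))) _)
  have hG0 : 0 ≤ ∫ x in ball x₀ d, g x ^ q := setIntegral_nonneg measurableSet_ball fun x hx =>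
    Real.rpow_nonneg (hg0 x (hd (ball_subset_closedBall hx))) _
  have hr6 : (r ^ n)⁻¹ ≤ (r ^ 6)⁻¹ := by
    apply inv_anti₀ (by positivity)
    exact pow_le_pow_of_le_one hr0.le (hr.2.le.trans hd1) hn6
  have h7 : (r ^ n)⁻¹ * ∫ x in ball x₀ r, g x ^ q ≤ (r ^ 6)⁻¹ * ∫ x in ball x₀ d, g x ^ q := by
    calc _ ≤ (r ^ n)⁻¹ * ∫ x in ball x₀ d, g x ^ q := by gcongr
      _ ≤ _ := by gcongr
  have h8 := mul_le_mul_of_nonneg_left h7 hμ.le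
  have h9 := mul_le_mul_of_nonneg_left
    (h1.trans (by gcongr : _ ≤ μ * ((r ^ 6)⁻¹ * ∫ x in ball x₀ d, g x ^ q) +
      volume.real (ball (0 : Euc n) 1) * μ ^ (-1 / (q - 1)))) hr0.le
  linarith

/-- **Interior sup bound** for `-Δw ≤ g` in dimension at most six, with `g ∈ L^q`, `q > 3`. -/
lemma exists_sup_bound (n : ℕ) (hn6 : n ≤ 6) {q : ℝ} (hq : 3 < q) : ∃ C : ℝ, 0 < C ∧
    ∀ (U : Set (Euc n)) (w : Euc n → ℝ) (w' : Euc n → Euc n →L[ℝ] ℝ)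
      (w'' : Fin n → Euc n → Euc n →L[ℝ] ℝ) (g : Euc n → ℝ) (x₀ : Euc n) (d μ : ℝ),
      IsOpen U → HasC2On U w w' w'' → (∀ x ∈ U, 0 ≤ w x) → (∀ x ∈ U, 0 ≤ g x) →
      ContinuousOn g U → (∀ x ∈ U, -∑ i, w'' i x (stdVec i) ≤ g x) →
      0 < d → d ≤ 1 → closedBall x₀ d ⊆ U → 0 < μ →
      w x₀ ≤ C * ((d ^ 6)⁻¹ * (∫ x in ball x₀ d, w x) + μ * (∫ x in ball x₀ d, g x ^ q)
        + μ ^ (-1 / (q - 1))) := by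
  set c : ℝ := ∫ z in ball (0 : Euc n) 1, bump 1 3 z with hc
  have hc0 : 0 < c := by
    rw [hc, setIntegral_pos_iff_support_of_nonneg_ae]
    · have : Function.support (bump (n := n) 1 3) ∩ ball 0 1 = ball 0 1 := by
        refine inter_eq_right.2 fun z hz => ?_
        have hz1 : ‖z‖ < 1 := by simpa using hz
        have : 0 < 1 - ‖z‖ ^ 2 := by nlinarith [norm_nonneg z]
        simp only [Function.mem_support, bump]
        rw [max_eq_right this.le]
        positivity
      rw [this]
      exact measure_ball_pos _ _ one_pos
    · exact Eventually.of_forall fun z => bump_nonneg z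
    · exact (continuous_bump.continuousOn.integrableOn_compact
        (isCompact_closedBall (0 : Euc n) 1)).mono_set ball_subset_closedBall
  set V : ℝ := volume.real (ball (0 : Euc n) 1) with hV
  have hV0 : 0 ≤ V := measureReal_nonneg
  have hq3 : 0 < q - 3 := by linarith
  have hq1 : 0 < q - 1 := by linarith
  refine ⟨c⁻¹ * (1 + 1 / (8 * (q - 3)) + V * (q - 1) / (8 * (q - 3))), by positivity, ?_⟩
  intro U w w' w'' g x₀ d μ hU hw hw0 hg0 hgc hlap hd0 hd1 hd hμ
  set G : ℝ := ∫ x in ball x₀ d, g x ^ q with hG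
  have hG0 : 0 ≤ G := setIntegral_nonneg measurableSet_ball fun x hx =>
    Real.rpow_nonneg (hg0 x (hd (ball_subset_closedBall hx))) _
  set m : ℝ := μ ^ (-1 / (q - 1)) with hm
  have hm0 : 0 ≤ m := by positivity
  set M : ℝ → ℝ := fun r => ∫ z in ball (0 : Euc n) 1, w (x₀ + r • z) * bump 1 3 z with hM
  set N : ℝ → ℝ := fun r => M r + (μ * G / (8 * (q - 3)) * r ^ (q - 3) +
    m * V * (q - 1) / (8 * (q - 3)) * r ^ ((q - 3) / (q - 1))) with hN
  have hderiv : ∀ r ∈ Ioo 0 d, HasDerivAt N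
      ((∫ z in ball (0 : Euc n) 1, w' (x₀ + r • z) z * bump 1 3 z) +
        (μ * G / (8 * (q - 3)) * ((q - 3) * r ^ (q - 3 - 1)) +
        m * V * (q - 1) / (8 * (q - 3)) *
          ((q - 3) / (q - 1) * r ^ ((q - 3) / (q - 1) - 1)))) r := fun r hr =>
    (hasDerivAt_integral_bump hw.1 hd hr).add
      (((Real.hasDerivAt_rpow_const (Or.inl hr.1.ne')).const_mul _).add
        ((Real.hasDerivAt_rpow_const (Or.inl hr.1.ne')).const_mul _))
  have hmono : MonotoneOn N (Icc 0 d) := by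
    refine monotoneOn_of_deriv_nonneg (convex_Icc 0 d) ?_ ?_ ?_
    · refine (continuousOn_integral_bump hw.1.continuousOn hd).add (Continuous.continuousOn ?_)
      exact (continuous_const.mul (Real.continuous_rpow_const hq3.le)).add
        (continuous_const.mul (Real.continuous_rpow_const (by positivity)))
    · rw [interior_Icc]
      exact fun r hr => (hderiv r hr).differentiableAt.differentiableWithinAt
    · rw [interior_Icc]
      intro r hr
      have hr0 : 0 < r := hr.1
      rw [(hderiv r hr).deriv]
      have h1 := integral_le_of_neg_laplacian_le (q := q) (μ := μ * r ^ (q + 1)) hn6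
        (by linarith) (by positivity) hU hw hg0 hgc hlap hd1 hd hr
      have h2 : r * (μ * r ^ (q + 1) * ((r ^ 6)⁻¹ * G)) = μ * G * r ^ (q - 3 - 1) := by
        have : r ^ (q - 3 - 1) = r * r ^ (q + 1) * (r ^ 6)⁻¹ := by
          rw [show q - 3 - 1 = 1 + (q + 1) - (6 : ℕ) by push_cast; ring,
            Real.rpow_sub hr0, Real.rpow_add hr0, Real.rpow_one, Real.rpow_natCast]
          field_simp
        rw [this]; ring
      have h3 : r * ((μ * r ^ (q + 1)) ^ (-1 / (q - 1)) * V) =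
          m * V * r ^ ((q - 3) / (q - 1) - 1) := by
        have h5 : (r ^ (q + 1)) ^ (-1 / (q - 1)) * r = r ^ ((q - 3) / (q - 1) - 1) := by
          rw [← Real.rpow_mul hr0.le, ← Real.rpow_add_one hr0.ne']
          congr 1
          field_simp
          ring
        rw [Real.mul_rpow hμ.le (by positivity), ← h5]
        ring
      rw [mul_add, h2, h3] at h1
      have h4 : μ * G / (8 * (q - 3)) * ((q - 3) * r ^ (q - 3 - 1)) +
          m * V * (q - 1) / (8 * (q - 3)) * ((q - 3) / (q - 1) * r ^ ((q - 3) / (q - 1) - 1)) =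
          (μ * G * r ^ (q - 3 - 1) + m * V * r ^ ((q - 3) / (q - 1) - 1)) / 8 := by
        field_simp
      rw [h4]
      linarith
  have hend := hmono (left_mem_Icc.2 hd0.le) (right_mem_Icc.2 hd0.le) hd0.le
  have hN0 : N 0 = w x₀ * c := by
    simp only [hN, hM, zero_smul, add_zero, integral_const_mul, ← hc]
    rw [Real.zero_rpow hq3.ne', Real.zero_rpow (show (q - 3) / (q - 1) ≠ 0 by positivity)]
    ring
  have hNd : N d ≤ (d ^ 6)⁻¹ * (∫ x in ball x₀ d, w x) + (μ * G / (8 * (q - 3)) +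
      m * V * (q - 1) / (8 * (q - 3))) := by
    have h1 : M d ≤ (d ^ n)⁻¹ * ∫ x in ball x₀ d, w x := by
      rw [← integral_ball_comp_affine w x₀ hd0]
      have hmaps : MapsTo (fun z : Euc n => x₀ + d • z) (closedBall 0 1)
          (closedBall x₀ d) := fun z hz =>
        add_smul_mem_closedBall hd0.le le_rfl (by simpa using hz)
      have hwc := (hw.1.continuousOn.mono hd).comp (by fun_prop) hmaps
      refine setIntegral_mono_on ?_ ?_ measurableSet_ball fun z hz => ?_
      · exact ((hwc.mul continuous_bump.continuousOn).integrableOn_compact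
          (isCompact_closedBall _ _)).mono_set ball_subset_closedBall
      · exact (hwc.integrableOn_compact
          (isCompact_closedBall _ _)).mono_set ball_subset_closedBall
      · exact mul_le_of_le_one_right (hw0 _ (hd (hmaps (ball_subset_closedBall hz))))
          (bump_le_one le_rfl z)
    have h2 : 0 ≤ ∫ x in ball x₀ d, w x := setIntegral_nonneg measurableSet_ball fun x hx =>
      hw0 x (hd (ball_subset_closedBall hx))
    have h3 : (d ^ n)⁻¹ ≤ (d ^ 6)⁻¹ :=
      inv_anti₀ (by positivity) (pow_le_pow_of_le_one hd0.le hd1 hn6)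
    have h4 : d ^ (q - 3) ≤ 1 := Real.rpow_le_one hd0.le hd1 hq3.le
    have h5 : d ^ ((q - 3) / (q - 1)) ≤ 1 := Real.rpow_le_one hd0.le hd1 (by positivity)
    refine add_le_add (h1.trans (by gcongr)) (add_le_add ?_ ?_)
    · exact mul_le_of_le_one_right (by positivity) h4
    · exact mul_le_of_le_one_right (by positivity) h5
  have hw2 : 0 ≤ (d ^ 6)⁻¹ * ∫ x in ball x₀ d, w x :=
    mul_nonneg (by positivity) (setIntegral_nonneg measurableSet_ball fun x hx =>
      hw0 x (hd (ball_subset_closedBall hx)))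
  rw [hN0] at hend
  have hfin := hend.trans hNd
  rw [← le_div_iff₀ hc0] at hfin
  refine hfin.trans ?_
  rw [div_eq_inv_mul, mul_assoc c⁻¹]
  refine mul_le_mul_of_nonneg_left ?_ (inv_nonneg.2 hc0.le)
  set A := (d ^ 6)⁻¹ * ∫ x in ball x₀ d, w x
  have e1 : μ * G / (8 * (q - 3)) = (1 / (8 * (q - 3))) * (μ * G) := by ring
  have e2 : m * V * (q - 1) / (8 * (q - 3)) = (V * (q - 1) / (8 * (q - 3))) * m := by ring
  rw [e1, e2]
  have p1 : 0 ≤ 1 / (8 * (q - 3)) := by positivity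
  have p2 : 0 ≤ V * (q - 1) / (8 * (q - 3)) := by positivity
  have p3 : 0 ≤ μ * G := by positivity
  nlinarith [mul_nonneg p1 hw2, mul_nonneg p1 hm0, mul_nonneg p2 hw2, mul_nonneg p2 p3]

end MeanValueBound

section Stability

variable {n : ℕ} {ξ : Euc n → ℝ} {ξ' : Euc n → Euc n →L[ℝ] ℝ} {r : ℝ}

lemma sum_sq_apply_stdVec (L : Euc n →L[ℝ] ℝ) : ∑ i, L (stdVec i) ^ 2 = ‖L‖ ^ 2 := by
  set v : Euc n := (InnerProductSpace.toDual ℝ (Euc n)).symm L with hv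
  have hL : L = InnerProductSpace.toDual ℝ (Euc n) v := by simp [hv]
  rw [hL, LinearIsometryEquiv.norm_map, EuclideanSpace.real_norm_sq_eq]
  refine Finset.sum_congr rfl fun i _ => ?_
  rw [InnerProductSpace.toDual_apply_apply, EuclideanSpace.inner_single_right]
  simp

lemma norm_gradient (ξ : Euc n → ℝ) (x : Euc n) : ‖gradient ξ x‖ = ‖fderiv ℝ ξ x‖ := by
  rw [gradient, LinearIsometryEquiv.norm_map]

lemma HasC1On.deriv_eq_zero {Kc : Set (Euc n)} (hK : IsClosed Kc) (hξ : HasC1On univ ξ ξ')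
    (h0 : ∀ x ∉ Kc, ξ x = 0) {x : Euc n} (hx : x ∉ Kc) : ξ' x = 0 := by
  have hev : ξ =ᶠ[𝓝 x] fun _ => 0 :=
    Filter.mem_of_superset (hK.isOpen_compl.mem_nhds hx) fun y hy => h0 y hy
  rw [← (hξ.1 x (mem_univ x)).fderiv, hev.fderiv_eq]
  simp

/-- Mollification: a `C¹` function supported in a ball is `C¹`-close to smooth functions supported
in slightly larger balls. -/
lemma HasC1On.exists_contDiff_approx (hξ : HasC1On univ ξ ξ')
    (h0 : ∀ x ∉ closedBall 0 r, ξ x = 0) {r' : ℝ} (hr' : r < r') {ε : ℝ} (hε : 0 < ε) :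
    ∃ g : Euc n → ℝ, ContDiff ℝ (⊤ : ℕ∞) g ∧ (∀ x ∉ closedBall 0 r', g x = 0) ∧
      ∀ x, |g x - ξ x| ≤ ε ∧ ‖fderiv ℝ g x - ξ' x‖ ≤ ε := by
  have hfd : fderiv ℝ ξ = ξ' := funext fun x => (hξ.1 x (mem_univ x)).fderiv
  have hc : Continuous ξ := continuousOn_univ.1 hξ.continuousOn
  have hc' : Continuous ξ' := continuousOn_univ.1 hξ.2
  have hcd : ContDiff ℝ 1 ξ := by
    rw [contDiff_one_iff_fderiv, hfd]
    exact ⟨fun x => (hξ.1 x (mem_univ x)).differentiableAt, hc'⟩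
  have hs : HasCompactSupport ξ := HasCompactSupport.intro (isCompact_closedBall 0 r) h0
  have hs' : HasCompactSupport ξ' := HasCompactSupport.intro (isCompact_closedBall 0 r)
    fun x hx => hξ.deriv_eq_zero isClosed_closedBall h0 hx
  obtain ⟨δ₁, hδ₁, h₁⟩ :=
    Metric.uniformContinuous_iff.1 (hs.uniformContinuous_of_continuous hc) ε hε
  obtain ⟨δ₂, hδ₂, h₂⟩ :=
    Metric.uniformContinuous_iff.1 (hs'.uniformContinuous_of_continuous hc') ε hε
  set δ := min (min δ₁ δ₂) (r' - r) with hδ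
  have hδ0 : 0 < δ := lt_min (lt_min hδ₁ hδ₂) (by linarith)
  let φ : ContDiffBump (0 : Euc n) := ⟨δ / 2, δ, by positivity, by linarith⟩
  set g : Euc n → ℝ := convolution (φ.normed volume) ξ (ContinuousLinearMap.lsmul ℝ ℝ) volume
    with hg
  have hgd : ∀ x, fderiv ℝ g x =
      convolution (φ.normed volume) ξ' (ContinuousLinearMap.lsmul ℝ ℝ) volume x := fun x => by
    have := hs.hasFDerivAt_convolution_right (ContinuousLinearMap.lsmul ℝ ℝ) (μ := volume)
      (φ.continuous_normed (μ := volume)).locallyIntegrable hcd x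
    rw [this.fderiv, hfd]
    simp only [convolution]
    congr 1
  refine ⟨g, ?_, fun x hx => ?_, fun x => ⟨?_, ?_⟩⟩
  · exact φ.hasCompactSupport_normed.contDiff_convolution_left _ φ.contDiff_normed
      hc.locallyIntegrable
  · have hx1 : r' < ‖x‖ := by simpa using hx
    have hz : ∀ y ∈ ball x δ, ξ y = 0 := fun y hy => by
      refine h0 y fun hy' => ?_
      have e1 : dist y x < δ := hy
      have e2 : ‖y‖ ≤ r := by simpa using hy'
      have e3 : ‖x‖ ≤ ‖y‖ + dist y x := by
        rw [dist_eq_norm]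
        have := norm_sub_norm_le x y
        rw [norm_sub_rev] at this; linarith
      have e4 : δ ≤ r' - r := min_le_right _ _
      linarith
    have := φ.dist_normed_convolution_le (μ := volume) (x₀ := x) (g := ξ) (ε := 0)
      hc.aestronglyMeasurable fun y hy => by
        rw [hz y hy, hz x (mem_ball_self hδ0)]; simp
    have h2 := dist_le_zero.1 this
    rw [hg, h2, hz x (mem_ball_self hδ0)]
  · rw [← Real.dist_eq]
    refine φ.dist_normed_convolution_le hc.aestronglyMeasurable fun y hy => (h₁ ?_).le
    exact lt_of_lt_of_le hy ((min_le_left _ _).trans (min_le_left _ _))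
  · rw [hgd, ← dist_eq_norm]
    refine φ.dist_normed_convolution_le hc'.aestronglyMeasurable fun y hy => (h₂ ?_).le
    exact lt_of_lt_of_le hy ((min_le_left _ _).trans (min_le_right _ _))

/-- Stability can be tested on `C¹` functions. -/
lemma StableSol.of_hasC1On {f' : ℝ → ℝ} {u : Euc n → ℝ} {R : ℝ} (hst : StableSol f' u (ball 0 R))
    (hc : ContinuousOn (fun x => f' (u x)) (ball 0 R)) (hr : r < R)
    (hξ : HasC1On univ ξ ξ') (h0 : ∀ x ∉ closedBall 0 r, ξ x = 0) :
    0 ≤ ∫ x in ball (0 : Euc n) R, (∑ i, ξ' x (stdVec i) ^ 2 - f' (u x) * ξ x ^ 2) := by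
  obtain ⟨r', hr1, hr2⟩ := exists_between hr
  have hsub : closedBall (0 : Euc n) r' ⊆ ball 0 R := closedBall_subset_ball hr2
  have hcξ : Continuous ξ := continuousOn_univ.1 hξ.continuousOn
  have hcξ' : Continuous ξ' := continuousOn_univ.1 hξ.2
  have hs : HasCompactSupport ξ := HasCompactSupport.intro (isCompact_closedBall 0 r) h0
  have hs' : HasCompactSupport ξ' := HasCompactSupport.intro (isCompact_closedBall 0 r)
    fun x hx => hξ.deriv_eq_zero isClosed_closedBall h0 hx
  obtain ⟨A, hA⟩ := hcξ.bounded_above_of_compact_support hs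
  obtain ⟨A', hA'⟩ := hcξ'.bounded_above_of_compact_support hs'
  obtain ⟨B, hB⟩ := (isCompact_closedBall (0 : Euc n) r').exists_bound_of_continuousOn
    (hc.mono hsub)
  choose g hg1 hg2 hg3 using fun k : ℕ =>
    hξ.exists_contDiff_approx h0 hr1 (ε := 1 / ((k : ℝ) + 1)) (by positivity)
  have hk1 : ∀ k : ℕ, 1 / ((k : ℝ) + 1) ≤ 1 := fun k => by
    rw [div_le_one (by positivity)]; have : (0 : ℝ) ≤ k := by positivity
    linarith
  have hlim : Tendsto (fun k : ℕ => 1 / ((k : ℝ) + 1)) atTop (𝓝 0) :=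
    tendsto_one_div_add_atTop_nhds_zero_nat
  have hgd0 : ∀ k, ∀ x ∉ closedBall 0 r', fderiv ℝ (g k) x = 0 := fun k x hx => by
    have hev : g k =ᶠ[𝓝 x] fun _ => 0 :=
      Filter.mem_of_superset (isClosed_closedBall.isOpen_compl.mem_nhds hx) fun y hy => hg2 k y hy
    rw [hev.fderiv_eq]; simp
  have hT : Tendsto (fun k => ∫ x in ball (0 : Euc n) R,
      (‖fderiv ℝ (g k) x‖ ^ 2 - f' (u x) * g k x ^ 2)) atTop
      (𝓝 (∫ x in ball (0 : Euc n) R, (‖ξ' x‖ ^ 2 - f' (u x) * ξ x ^ 2))) := by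
    refine tendsto_integral_of_dominated_convergence
      (fun _ => (A' + 1) ^ 2 + |B| * (A + 1) ^ 2) (fun k => ?_) ?_ (fun k => ?_) ?_
    · refine ContinuousOn.aestronglyMeasurable ?_ measurableSet_ball
      exact ((((hg1 k).continuous_fderiv (by simp)).norm.pow 2).continuousOn).sub
        (hc.mul (((hg1 k).continuous.pow 2).continuousOn))
    · exact integrableOn_const (by simp [measure_ball_lt_top.ne])
    · refine ae_restrict_of_forall_mem measurableSet_ball fun x hx => ?_
      by_cases hx' : x ∈ closedBall 0 r'
      · have e1 : ‖fderiv ℝ (g k) x‖ ≤ A' + 1 := by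
          have h1 := (hg3 k x).2.trans (hk1 k)
          have h2 := norm_sub_norm_le (fderiv ℝ (g k) x) (ξ' x)
          linarith [hA' x]
        have e2 : |g k x| ≤ A + 1 := by
          have h1 := (hg3 k x).1.trans (hk1 k)
          have h2 := abs_sub_abs_le_abs_sub (g k x) (ξ x)
          have h3 := hA x
          rw [Real.norm_eq_abs] at h3
          linarith
        have e3 : |f' (u x)| ≤ |B| := (hB x hx').trans (le_abs_self B)
        rw [Real.norm_eq_abs]
        refine (abs_sub _ _).trans (add_le_add ?_ ?_)
        · rw [abs_of_nonneg (by positivity)]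
          exact pow_le_pow_left₀ (norm_nonneg _) e1 2
        · rw [abs_mul, abs_pow]
          exact mul_le_mul e3 (pow_le_pow_left₀ (abs_nonneg _) e2 2) (by positivity) (abs_nonneg _)
      · rw [hgd0 k x hx', hg2 k x hx']
        simp only [norm_zero]
        norm_num
        positivity
    · refine ae_of_all _ fun x => ?_
      have t1 : Tendsto (fun k => g k x) atTop (𝓝 (ξ x)) :=
        tendsto_iff_dist_tendsto_zero.2 (squeeze_zero (fun _ => dist_nonneg)
          (fun k => by rw [Real.dist_eq]; exact (hg3 k x).1) hlim)
      have t2 : Tendsto (fun k => fderiv ℝ (g k) x) atTop (𝓝 (ξ' x)) :=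
        tendsto_iff_dist_tendsto_zero.2 (squeeze_zero (fun _ => dist_nonneg)
          (fun k => by rw [dist_eq_norm]; exact (hg3 k x).2) hlim)
      exact (t2.norm.pow 2).sub ((t1.pow 2).const_mul _)
  simp only [sum_sq_apply_stdVec]
  refine ge_of_tendsto' hT fun k => ?_
  have := hst (g k) (hg1 k) (HasCompactSupport.intro (isCompact_closedBall 0 r') (hg2 k))
    ((closure_minimal (fun x (hx : g k x ≠ 0) => by_contra fun h => hx (hg2 k x h))
      isClosed_closedBall).trans hsub)
  simpa only [norm_gradient] using this

end Stability

/-- A `C²` nonlinearity on `[0, m]` which is nonnegative, nondecreasing and satisfies the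
Crandall–Rabinowitz type condition `f'' f ≥ (1 + θ) f'² - κ²`. -/
structure IsCRNonlinearity (m θ κ : ℝ) (f f' f'' : ℝ → ℝ) : Prop where
  zero_le : 0 ≤ m
  theta_pos : 0 < θ
  one_le : 1 ≤ κ
  deriv : ∀ t ∈ Icc 0 m, HasDerivWithinAt f (f' t) (Icc 0 m) t
  deriv' : ∀ t ∈ Icc 0 m, HasDerivWithinAt f' (f'' t) (Icc 0 m) t
  cont'' : ContinuousOn f'' (Icc 0 m)
  nonneg : ∀ t ∈ Icc 0 m, 0 ≤ f t
  nonneg' : ∀ t ∈ Icc 0 m, 0 ≤ f' t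
  cr : ∀ t ∈ Icc 0 m, (1 + θ) * f' t ^ 2 - κ ^ 2 ≤ f'' t * f t

section Primitive

variable {m : ℝ} {h h₁ g g' : ℝ → ℝ}

lemma hasDerivWithinAt_primitive (hc : ContinuousOn h (Icc 0 m)) :
    ∀ t ∈ Icc 0 m, HasDerivWithinAt (fun t => ∫ s in (0 : ℝ)..t, h s) (h t) (Icc 0 m) t := by
  intro t ht
  have hm : 0 ≤ m := ht.1.trans ht.2
  have : Fact (t ∈ Icc 0 m) := ⟨ht⟩
  refine intervalIntegral.integral_hasDerivWithinAt_right ?_ ?_ (hc t ht)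
  · refine ContinuousOn.intervalIntegrable (hc.mono ?_)
    rw [uIcc_of_le ht.1]
    exact Icc_subset_Icc_right ht.2
  · exact ⟨Icc 0 m, self_mem_nhdsWithin, hc.aestronglyMeasurable measurableSet_Icc⟩

lemma le_of_hasDerivWithinAt_nonneg (hg : ∀ t ∈ Icc 0 m, HasDerivWithinAt g (g' t) (Icc 0 m) t)
    {s t : ℝ} (hs : 0 ≤ s) (hst : s ≤ t) (ht : t ≤ m) (h0 : ∀ x ∈ Icc s t, 0 ≤ g' x) :
    g s ≤ g t := by
  have hsub : Icc s t ⊆ Icc 0 m := Icc_subset_Icc hs ht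
  refine monotoneOn_of_hasDerivWithinAt_nonneg (convex_Icc s t) (f := g) (f' := g')
    (fun x hx => ((hg x (hsub hx)).continuousWithinAt).mono hsub)
    (fun x hx => (hg x (hsub (interior_subset hx))).mono (interior_subset.trans hsub))
    (fun x hx => h0 x (interior_subset hx)) (left_mem_Icc.2 hst) (right_mem_Icc.2 hst) hst

lemma integral_le_mul_of_monotone {t B : ℝ} (hc : ContinuousOn h (Icc 0 m)) (ht : t ∈ Icc 0 m)
    (hB : ∀ s ∈ Icc 0 t, h s ≤ B) : ∫ s in (0 : ℝ)..t, h s ≤ t * B := by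
  have hd := hasDerivWithinAt_primitive hc
  have h2 := le_of_hasDerivWithinAt_nonneg (m := m)
    (g := fun t => t * B - ∫ s in (0 : ℝ)..t, h s) (g' := fun t => B - h t)
    (fun x hx => (((hasDerivWithinAt_id x _).mul_const B).sub (hd x hx)).congr_deriv (by simp))
    le_rfl ht.1 ht.2 (fun x hx => sub_nonneg.2 (hB x hx))
  simp only [zero_mul, intervalIntegral.integral_same, sub_zero] at h2
  linarith

lemma integral_zero_le_of_nonneg {t : ℝ} (ht : t ∈ Icc 0 m) (h0 : ∀ s ∈ Icc 0 m, 0 ≤ h s) :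
    0 ≤ ∫ s in (0 : ℝ)..t, h s :=
  intervalIntegral.integral_nonneg ht.1 fun s hs => h0 s ⟨hs.1, hs.2.trans ht.2⟩

end Primitive

namespace IsCRNonlinearity

variable {m θ κ : ℝ} {f f' f'' : ℝ → ℝ} {s t : ℝ}

lemma continuousOn (hf : IsCRNonlinearity m θ κ f f' f'') : ContinuousOn f (Icc 0 m) :=
  fun t ht => (hf.deriv t ht).continuousWithinAt

lemma continuousOn' (hf : IsCRNonlinearity m θ κ f f' f'') : ContinuousOn f' (Icc 0 m) :=
  fun t ht => (hf.deriv' t ht).continuousWithinAt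

lemma monotone (hf : IsCRNonlinearity m θ κ f f' f'') (hs : 0 ≤ s) (hst : s ≤ t) (ht : t ≤ m) :
    f s ≤ f t :=
  le_of_hasDerivWithinAt_nonneg hf.deriv hs hst ht fun x hx =>
    hf.nonneg' x ⟨hs.trans hx.1, hx.2.trans ht⟩
/-- `f'` is almost nondecreasing. -/
lemma deriv_le_add (hf : IsCRNonlinearity m θ κ f f' f'') (hs : 0 ≤ s) (hst : s ≤ t)
    (ht : t ≤ m) : f' s ≤ f' t + κ := by
  have hκ := hf.one_le
  have hθ := hf.theta_pos
  have hsub : Icc s t ⊆ Icc 0 m := Icc_subset_Icc hs ht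
  have hft := hf.nonneg' t (hsub (right_mem_Icc.2 hst))
  by_contra! hcon
  have key : ∀ ⦃x⦄, x ∈ Icc s t → (fun x => -f' x) x ≤ (fun _ => -f' s) x := by
    refine image_le_of_deriv_right_lt_deriv_boundary' (f' := fun x => -f'' x) (B' := fun _ => 0)
      (hf.continuousOn'.mono hsub).neg (fun x hx => ?_) le_rfl continuousOn_const
      (fun x _ => hasDerivWithinAt_const _ _ _) (fun x hx hxe => ?_)
    · have hxm : x < m := hx.2.trans_le ht
      have h1 := (hf.deriv' x (hsub ⟨hx.1, hx.2.le⟩)).neg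
      refine h1.mono_of_mem_nhdsWithin (Filter.mem_of_superset (Ico_mem_nhdsGE hxm) ?_)
      exact fun y hy => ⟨(hs.trans hx.1).trans hy.1, hy.2.le⟩
    · have hxe' : f' x = f' s := by simpa using hxe
      have hx' := hsub ⟨hx.1, hx.2.le⟩
      have h1 := hf.cr x hx'
      have h2 := hf.nonneg x hx'
      rw [hxe'] at h1
      have h3 : 0 < f'' x * f x := by nlinarith [sq_nonneg (f' s)]
      have h4 : 0 < f'' x := pos_of_mul_pos_left h3 h2
      simpa using h4
  have := key (right_mem_Icc.2 hst)
  simp only [neg_le_neg_iff] at this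
  linarith

lemma le_add_mul (hf : IsCRNonlinearity m θ κ f f' f'') (ht : t ∈ Icc 0 m) :
    f t ≤ f 0 + t * (f' t + κ) := by
  have h := le_of_hasDerivWithinAt_nonneg (m := m)
    (g := fun s => s * (f' t + κ) - f s) (g' := fun s => (f' t + κ) - f' s)
    (fun x hx => (((hasDerivWithinAt_id x _).mul_const (f' t + κ)).sub
      (hf.deriv x hx)).congr_deriv (by simp))
    le_rfl ht.1 ht.2 (fun x hx => sub_nonneg.2 (hf.deriv_le_add hx.1 hx.2 ht.2))
  simp only [zero_mul] at h
  linarith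

lemma sq_le_add_mul (hf : IsCRNonlinearity m θ κ f f' f'') (ht : t ∈ Icc 0 m) :
    f t ^ 2 ≤ f 0 ^ 2 + 2 * (∫ s in (0 : ℝ)..t, f s) * (f' t + κ) := by
  have hF := hasDerivWithinAt_primitive hf.continuousOn
  have h := le_of_hasDerivWithinAt_nonneg (m := m)
    (g := fun s => (∫ x in (0 : ℝ)..s, f x) * (2 * (f' t + κ)) - f s ^ 2)
    (g' := fun s => f s * (2 * (f' t + κ)) - 2 * f s * f' s)
    (fun x hx => (((hF x hx).mul_const (2 * (f' t + κ))).sub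
      ((hf.deriv x hx).pow 2)).congr_deriv (by simp))
    le_rfl ht.1 ht.2 (fun x hx => by
      have h1 := hf.deriv_le_add hx.1 hx.2 ht.2
      have h2 := hf.nonneg x ⟨hx.1, hx.2.trans ht.2⟩
      nlinarith)
  simp only [intervalIntegral.integral_same, zero_mul] at h
  linarith

lemma primitive_nonneg (hf : IsCRNonlinearity m θ κ f f' f'') (ht : t ∈ Icc 0 m) :
    0 ≤ ∫ s in (0 : ℝ)..t, f s :=
  integral_zero_le_of_nonneg ht hf.nonneg

lemma primitive_le (hf : IsCRNonlinearity m θ κ f f' f'') (ht : t ∈ Icc 0 m) :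
    ∫ s in (0 : ℝ)..t, f s ≤ t * f t :=
  integral_le_mul_of_monotone hf.continuousOn ht fun _ hs => hf.monotone hs.1 hs.2 ht.2

/-- The test functions in the Crandall–Rabinowitz argument: with `b = 2a - 2`, functions `ψ, Ψ`
with `Ψ' = ψ` and `ψ' ≥ ((f^a)')²`. -/
lemma exists_test_functions (hf : IsCRNonlinearity m θ κ f f' f'') {b : ℝ} (hb : 2 < b) :
    ∃ ψ ψ' Ψ : ℝ → ℝ, ContinuousOn ψ' (Icc 0 m) ∧
      (∀ t ∈ Icc 0 m, HasDerivWithinAt ψ (ψ' t) (Icc 0 m) t) ∧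
      (∀ t ∈ Icc 0 m, HasDerivWithinAt Ψ (ψ t) (Icc 0 m) t) ∧
      ∀ t ∈ Icc 0 m, (b + 2 + θ) * (f t ^ b * f' t ^ 2) ≤ ψ' t ∧
        ψ t ≤ f t ^ b * f t * f' t + κ ^ 2 * (t * f t ^ b) ∧ 0 ≤ Ψ t ∧
        Ψ t ≤ f t ^ b * f t ^ 2 + κ ^ 2 * (t ^ 2 * f t ^ b) := by
  have hb0 : 0 < b := by linarith
  have hfb : ContinuousOn (fun t => f t ^ b) (Icc 0 m) :=
    hf.continuousOn.rpow_const fun _ _ => Or.inr hb0.le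
  have hfb0 : ∀ t ∈ Icc 0 m, 0 ≤ f t ^ b := fun t ht => Real.rpow_nonneg (hf.nonneg t ht) b
  have hmono : ∀ t ∈ Icc 0 m, ∀ s ∈ Icc 0 t, f s ^ b ≤ f t ^ b := fun t ht s hs =>
    Real.rpow_le_rpow (hf.nonneg s ⟨hs.1, hs.2.trans ht.2⟩) (hf.monotone hs.1 hs.2 ht.2) hb0.le
  set I₁ : ℝ → ℝ := fun t => ∫ s in (0 : ℝ)..t, f s ^ b with hI₁
  have hI₁d := hasDerivWithinAt_primitive hfb
  have hI₁c : ContinuousOn I₁ (Icc 0 m) := fun t ht => (hI₁d t ht).continuousWithinAt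
  have hI₁0 : ∀ t ∈ Icc 0 m, 0 ≤ I₁ t := fun t ht => integral_zero_le_of_nonneg ht hfb0
  have hI₁le : ∀ t ∈ Icc 0 m, I₁ t ≤ t * f t ^ b := fun t ht =>
    integral_le_mul_of_monotone hfb ht (hmono t ht)
  set I₂ : ℝ → ℝ := fun t => ∫ s in (0 : ℝ)..t, I₁ s with hI₂
  have hI₂d := hasDerivWithinAt_primitive hI₁c
  have hI₂0 : ∀ t ∈ Icc 0 m, 0 ≤ I₂ t := fun t ht => integral_zero_le_of_nonneg ht hI₁0
  have hI₂le : ∀ t ∈ Icc 0 m, I₂ t ≤ t ^ 2 * f t ^ b := fun t ht => by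
    have := integral_le_mul_of_monotone (B := t * f t ^ b) hI₁c ht fun s hs => by
      have hs' : s ∈ Icc 0 m := ⟨hs.1, hs.2.trans ht.2⟩
      exact (hI₁le s hs').trans (mul_le_mul hs.2 (hmono t ht s hs) (hfb0 s hs') ht.1)
    calc I₂ t ≤ t * (t * f t ^ b) := this
      _ = _ := by ring
  have e1 : ∀ t ∈ Icc 0 m, f t ^ (b + 1) = f t ^ b * f t := fun t ht => by
    rw [Real.rpow_add_one' (hf.nonneg t ht) (by linarith)]
  have e2 : ∀ t ∈ Icc 0 m, f t ^ (b + 2) = f t ^ b * f t ^ 2 := fun t ht => by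
    rw [show b + 2 = (b + 1) + 1 by ring, Real.rpow_add_one' (hf.nonneg t ht) (by linarith),
      e1 t ht]; ring
  refine ⟨fun t => f t ^ (b + 1) * f' t + κ ^ 2 * I₁ t,
    fun t => (b + 1) * (f t ^ b * f' t ^ 2) + f t ^ b * (f'' t * f t) + κ ^ 2 * f t ^ b,
    fun t => f t ^ (b + 2) / (b + 2) + κ ^ 2 * I₂ t, ?_, fun t ht => ?_, fun t ht => ?_,
    fun t ht => ⟨?_, ?_, ?_, ?_⟩⟩
  · exact ((continuousOn_const.mul (hfb.mul (hf.continuousOn'.pow 2))).add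
      (hfb.mul (hf.cont''.mul hf.continuousOn))).add (continuousOn_const.mul hfb)
  · have h1 := (((hf.deriv t ht).rpow_const (p := b + 1) (Or.inr (by linarith))).mul
      (hf.deriv' t ht)).add ((hI₁d t ht).const_mul (κ ^ 2))
    refine h1.congr_deriv ?_
    rw [e1 t ht, add_sub_cancel_right]; ring
  · have h1 := (((hf.deriv t ht).rpow_const (p := b + 2) (Or.inr (by linarith))).div_const
      (b + 2)).add ((hI₂d t ht).const_mul (κ ^ 2))
    refine h1.congr_deriv ?_
    have : b + 2 ≠ 0 := by linarith
    rw [show b + 2 - 1 = b + 1 by ring]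
    field_simp
  · have := mul_le_mul_of_nonneg_left (hf.cr t ht) (hfb0 t ht)
    nlinarith
  · simp only [e1 t ht]
    have := mul_le_mul_of_nonneg_left (hI₁le t ht) (sq_nonneg κ)
    linarith
  · have h1 : 0 ≤ f t ^ (b + 2) := Real.rpow_nonneg (hf.nonneg t ht) _
    have h2 := mul_nonneg (sq_nonneg κ) (hI₂0 t ht)
    positivity
  · simp only [e2 t ht]
    have h1 : 0 ≤ f t ^ b * f t ^ 2 := mul_nonneg (hfb0 t ht) (sq_nonneg _)
    have h2 : f t ^ b * f t ^ 2 / (b + 2) ≤ f t ^ b * f t ^ 2 := div_le_self h1 (by linarith)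
    have := mul_le_mul_of_nonneg_left (hI₂le t ht) (sq_nonneg κ)
    linarith

end IsCRNonlinearity

/-- A stable solution `u` of `-Δu = f(u)` in the unit ball, normalized by `∫ u ≤ 1`. -/
structure IsNormalizedStable {n : ℕ} (m θ κ : ℝ) (f f' f'' : ℝ → ℝ) (u : Euc n → ℝ)
    (u' : Euc n → Euc n →L[ℝ] ℝ) (u'' : Fin n → Euc n → Euc n →L[ℝ] ℝ) : Prop where
  nl : IsCRNonlinearity m θ κ f f' f''
  reg : HasC2On (ball 0 1) u u' u''
  mem : ∀ x ∈ ball (0 : Euc n) 1, u x ∈ Icc 0 m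
  eqn : ∀ x ∈ ball (0 : Euc n) 1, -∑ i, u'' i x (stdVec i) = f (u x)
  stable : StableSol f' u (ball 0 1)
  integrableOn : IntegrableOn u (ball 0 1)
  integral_le : ∫ x in ball (0 : Euc n) 1, u x ≤ 1

section Cutoff

variable {n : ℕ} {k : ℕ}

lemma bump_eq_zero_of_notMem (hk : k ≠ 0) {x : Euc n} (hx : x ∉ closedBall 0 (3 / 4)) :
    bump (9 / 16) k x = 0 := by
  have hx' : 3 / 4 < ‖x‖ := by simpa using hx
  exact bump_eq_zero hk (by nlinarith)

lemma closedBall_three_quarters_subset : closedBall (0 : Euc n) (3 / 4) ⊆ ball 0 1 :=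
  closedBall_subset_ball (by norm_num)

lemma integrableOn_of_vanish {h : Euc n → ℝ} (hh : ContinuousOn h (ball 0 1))
    (h0 : ∀ x ∉ closedBall 0 (3 / 4), h x = 0) : IntegrableOn h (ball 0 1) :=
  (integrable_of_vanish isOpen_ball (isCompact_closedBall 0 (3 / 4))
    closedBall_three_quarters_subset hh h0).integrableOn

lemma integrableOn_mul_bump {h : Euc n → ℝ} (hh : ContinuousOn h (ball 0 1)) (hk : k ≠ 0) :
    IntegrableOn (fun x => h x * bump (9 / 16) k x) (ball 0 1) :=
  integrableOn_of_vanish (hh.mul continuous_bump.continuousOn) fun x hx => by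
    rw [bump_eq_zero_of_notMem hk hx, mul_zero]

lemma HasC1On.extend {U Kc : Set (Euc n)} {a : Euc n → ℝ} {a' : Euc n → Euc n →L[ℝ] ℝ}
    (hU : IsOpen U) (hK : IsClosed Kc) (hKU : Kc ⊆ U) (ha : HasC1On U a a')
    (h0 : ∀ x ∉ Kc, a x = 0) (h0' : ∀ x ∉ Kc, a' x = 0) : HasC1On univ a a' := by
  refine ⟨fun x _ => ?_, (continuous_of_vanish hU hK hKU ha.2 h0').continuousOn⟩
  by_cases hx : x ∈ Kc
  · exact ha.1 x (hKU hx)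
  · have hev : a =ᶠ[𝓝 x] fun _ => 0 :=
      Filter.mem_of_superset (hK.isOpen_compl.mem_nhds hx) fun y hy => h0 y hy
    rw [h0' x hx]
    exact (hasFDerivAt_const 0 x).congr_of_eventuallyEq hev

lemma bump_add (ρ : ℝ) (j k : ℕ) (x : Euc n) : bump ρ (j + k) x = bump ρ j x * bump ρ k x :=
  pow_add _ _ _

end Cutoff

namespace IsNormalizedStable

variable {n : ℕ} {m θ κ : ℝ} {f f' f'' : ℝ → ℝ} {u : Euc n → ℝ}
  {u' : Euc n → Euc n →L[ℝ] ℝ} {u'' : Fin n → Euc n → Euc n →L[ℝ] ℝ}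

lemma continuousOn_comp (hc : IsNormalizedStable m θ κ f f' f'' u u' u'') {g : ℝ → ℝ}
    (hg : ContinuousOn g (Icc 0 m)) : ContinuousOn (fun x => g (u x)) (ball 0 1) :=
  hg.comp hc.reg.1.continuousOn hc.mem

/-- The stability inequality with test function `φ(u) η`, after integration by parts. -/
lemma integral_stability_nonneg (hc : IsNormalizedStable m θ κ f f' f'' u u' u'')
    {φ φ' ψ ψ' Ψ : ℝ → ℝ}
    (hφ : ∀ t ∈ Icc 0 m, HasDerivWithinAt φ (φ' t) (Icc 0 m) t) (hφ' : ContinuousOn φ' (Icc 0 m))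
    (hψ : ∀ t ∈ Icc 0 m, HasDerivWithinAt ψ (ψ' t) (Icc 0 m) t) (hψ' : ContinuousOn ψ' (Icc 0 m))
    (hΨ : ∀ t ∈ Icc 0 m, HasDerivWithinAt Ψ (ψ t) (Icc 0 m) t)
    (hle : ∀ t ∈ Icc 0 m, φ' t ^ 2 ≤ ψ' t) :
    IntegrableOn (fun x => ψ (u x) * f (u x) * bump (9 / 16) 64 x
      + Ψ (u x) * ∑ i, bumpDeriv₂ (9 / 16) 61 i x (stdVec i)
      - φ (u x) ^ 2 * (bump (9 / 16) 32 x * ∑ i, bumpDeriv₂ (9 / 16) 29 i x (stdVec i))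
      - f' (u x) * φ (u x) ^ 2 * bump (9 / 16) 64 x) (ball (0 : Euc n) 1) ∧
    0 ≤ ∫ x in ball (0 : Euc n) 1, (ψ (u x) * f (u x) * bump (9 / 16) 64 x
      + Ψ (u x) * ∑ i, bumpDeriv₂ (9 / 16) 61 i x (stdVec i)
      - φ (u x) ^ 2 * (bump (9 / 16) 32 x * ∑ i, bumpDeriv₂ (9 / 16) 29 i x (stdVec i))
      - f' (u x) * φ (u x) ^ 2 * bump (9 / 16) 64 x) := by
  have hU : IsOpen (ball (0 : Euc n) 1) := isOpen_ball
  have hK := isCompact_closedBall (0 : Euc n) (3 / 4)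
  have hKU := closedBall_three_quarters_subset (n := n)
  have hψc : ContinuousOn ψ (Icc 0 m) := fun t ht => (hψ t ht).continuousWithinAt
  have hφc : ContinuousOn φ (Icc 0 m) := fun t ht => (hφ t ht).continuousWithinAt
  have hΨc : ContinuousOn Ψ (Icc 0 m) := fun t ht => (hΨ t ht).continuousWithinAt
  have hφu := hc.reg.1.comp_real hU hφ hφ' hc.mem
  have hψu := hc.reg.1.comp_real hU hψ hψ' hc.mem
  have hΨu := hc.reg.1.comp_real hU hΨ hψc hc.mem
  have hη := hasC2On_bump (ball (0 : Euc n) 1) (9 / 16) 29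
  have hη₂ := hasC2On_bump (ball (0 : Euc n) 1) (9 / 16) 61
  norm_num at hη hη₂
  have hdη : ∀ x : Euc n, ∀ i, bumpDeriv (9 / 16) 62 x (stdVec i) =
      2 * bump (9 / 16) 32 x * bumpDeriv (9 / 16) 30 x (stdVec i) := fun x i => by
    rw [bumpDeriv_stdVec, bumpDeriv_stdVec, show 62 + 1 = 32 + (30 + 1) by rfl, bump_add]
    push_cast; ring
  have hη2 : ∀ x : Euc n, bump (9 / 16) 64 x = bump (9 / 16) 32 x * bump (9 / 16) 32 x :=
    fun x => bump_add (9 / 16) 32 32 x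
  have hb0 : ∀ k ≠ 0, ∀ x ∉ closedBall (0 : Euc n) (3 / 4), bump (9 / 16) k x = 0 :=
    fun k hk x hx => bump_eq_zero_of_notMem hk hx
  obtain ⟨i1, g1⟩ := integral_green hU hK hKU (hψu.mul hη₂.1) hc.reg
    (fun x hx => Or.inl (by rw [hb0 _ (by norm_num) x hx, mul_zero]))
  obtain ⟨i2, g2⟩ := integral_green hU hK hKU hΨu hη₂
    (fun x hx => Or.inr fun i => by
      rw [bumpDeriv_stdVec, hb0 _ (by norm_num) x hx, mul_zero, zero_mul])
  obtain ⟨i3, g3⟩ := integral_green hU hK hKU ((hφu.mul hφu).mul hη.1) hη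
    (fun x hx => Or.inl (by rw [hb0 _ (by norm_num) x hx, mul_zero]))
  have hξ := (hφu.mul hη.1).extend hU hK.isClosed hKU
    (fun x hx => by rw [hb0 _ (by norm_num) x hx, mul_zero])
    (fun x hx => by
      simp [bumpDeriv, hb0 31 (by norm_num) x hx, hb0 32 (by norm_num) x hx])
  have hst := hc.stable.of_hasC1On (r := 3 / 4) (hc.continuousOn_comp hc.nl.continuousOn')
    (by norm_num) hξ
    (fun x hx => by rw [hb0 _ (by norm_num) x hx, mul_zero])
  have iE := integrableOn_of_vanish
    (h := fun x => ∑ i, ((φ (u x) • bumpDeriv (9 / 16) 30 x +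
      bump (9 / 16) 32 x • φ' (u x) • u' x) (stdVec i)) ^ 2 -
      f' (u x) * (φ (u x) * bump (9 / 16) 32 x) ^ 2)
    (((continuousOn_finsetSum _ fun i _ => ((hφu.mul hη.1).continuousOn_apply _).pow 2)).sub
      ((hc.continuousOn_comp hc.nl.continuousOn').mul ((hφu.mul hη.1).continuousOn.pow 2)))
    (fun x hx => by
      rw [hb0 _ (by norm_num) x hx, bumpDeriv, hb0 _ (by norm_num) x hx]; simp)
  have cη : ∀ k : ℕ, ContinuousOn (bump (9 / 16) k) (ball (0 : Euc n) 1) :=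
    fun k => continuous_bump.continuousOn
  have iR := integrableOn_of_vanish
    (h := fun x => ψ (u x) * f (u x) * bump (9 / 16) 64 x
      + Ψ (u x) * ∑ i, bumpDeriv₂ (9 / 16) 61 i x (stdVec i)
      - φ (u x) ^ 2 * (bump (9 / 16) 32 x * ∑ i, bumpDeriv₂ (9 / 16) 29 i x (stdVec i))
      - f' (u x) * φ (u x) ^ 2 * bump (9 / 16) 64 x)
    (((((hψu.continuousOn.mul (hc.continuousOn_comp hc.nl.continuousOn)).mul (cη _)).add
      (hΨu.continuousOn.mul (continuousOn_finsetSum _ fun i _ =>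
        (hη₂.2 i).continuousOn_apply _))).sub
      ((hφu.continuousOn.pow 2).mul ((cη _).mul
        (continuousOn_finsetSum _ fun i _ => (hη.2 i).continuousOn_apply _)))).sub
      (((hc.continuousOn_comp hc.nl.continuousOn').mul (hφu.continuousOn.pow 2)).mul (cη _)))
    (fun x hx => by
      simp only [bumpDeriv₂_stdVec]
      norm_num
      rw [hb0 _ (by norm_num) x hx, hb0 _ (by norm_num) x hx, hb0 _ (by norm_num) x hx,
        hb0 _ (by norm_num) x hx]; simp)
  refine ⟨iR, hst.trans ?_⟩
  have hG := integral_add (i1.sub i2) i3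
  have hG' := integral_sub i1 i2
  simp only [Pi.sub_apply] at hG
  rw [hG', g1, g2, g3, sub_zero, add_zero] at hG
  have hGR := integral_add ((i1.sub i2).add i3) iR
  simp only [Pi.sub_apply, Pi.add_apply] at hGR
  rw [hG, zero_add] at hGR
  rw [← hGR]
  refine setIntegral_mono_on iE (((i1.sub i2).add i3).add iR) measurableSet_ball fun x hx => ?_
  have key : ∀ i, ((φ (u x) • bumpDeriv (9 / 16) 30 x +
        bump (9 / 16) 32 x • φ' (u x) • u' x) (stdVec i)) ^ 2 ≤
      ((ψ (u x) • bumpDeriv (9 / 16) 62 x + bump (9 / 16) 64 x • ψ' (u x) • u' x) (stdVec i) *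
          u' x (stdVec i) + ψ (u x) * bump (9 / 16) 64 x * u'' i x (stdVec i)) -
      ((ψ (u x) • u' x) (stdVec i) * bumpDeriv (9 / 16) 62 x (stdVec i) +
          Ψ (u x) * bumpDeriv₂ (9 / 16) 61 i x (stdVec i)) +
      (((φ (u x) * φ (u x)) • bumpDeriv (9 / 16) 30 x +
          bump (9 / 16) 32 x • (φ (u x) • φ' (u x) • u' x + φ (u x) • φ' (u x) • u' x)) (stdVec i) *
            bumpDeriv (9 / 16) 30 x (stdVec i) +
          φ (u x) * φ (u x) * bump (9 / 16) 32 x * bumpDeriv₂ (9 / 16) 29 i x (stdVec i)) +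
      (Ψ (u x) * bumpDeriv₂ (9 / 16) 61 i x (stdVec i) -
        ψ (u x) * bump (9 / 16) 64 x * u'' i x (stdVec i) -
        φ (u x) ^ 2 * bump (9 / 16) 32 x * bumpDeriv₂ (9 / 16) 29 i x (stdVec i)) := fun i => by
    simp only [add_apply, smul_apply, smul_eq_mul, hdη, hη2]
    nlinarith [mul_le_mul_of_nonneg_left (hle _ (hc.mem x hx))
      (sq_nonneg (bump (9 / 16) 32 x * u' x (stdVec i)))]
  have hsum := Finset.sum_le_sum fun i (_ : i ∈ Finset.univ) => key i
  rw [Finset.sum_add_distrib, Finset.sum_add_distrib, Finset.sum_sub_distrib,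
    Finset.sum_sub_distrib, Finset.sum_sub_distrib, ← Finset.mul_sum, ← Finset.mul_sum,
    ← Finset.mul_sum] at hsum
  rw [← hc.eqn x hx, hη2 x, mul_pow] at *
  linarith

end IsNormalizedStable

lemma integral_bump_pos {n k : ℕ} (hk : k ≠ 0) :
    0 < ∫ x in ball (0 : Euc n) 1, bump (9 / 16) k x := by
  rw [setIntegral_of_vanish closedBall_three_quarters_subset
    fun x hx => bump_eq_zero_of_notMem hk hx]
  refine continuous_bump.integral_pos_of_hasCompactSupport_nonneg_nonzero (x := 0)
    (HasCompactSupport.intro (isCompact_closedBall 0 (3 / 4))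
      fun x hx => bump_eq_zero_of_notMem hk hx) (fun x => bump_nonneg x) ?_
  simp [bump]

lemma stability_terms_le {P y y' v ψ Ψ c κ A D D' Z Z₃ Z₄ : ℝ} (hP : 0 ≤ P) (hy : 0 ≤ y)
    (hv : 0 ≤ v) (hc0 : 0 ≤ c) (hc1 : c < 1) (hA : 0 ≤ A) (hΨ0 : 0 ≤ Ψ)
    (hψ1 : ψ ≤ P * y * y' + κ ^ 2 * (v * P)) (hΨ1 : Ψ ≤ P * y ^ 2 + κ ^ 2 * (v ^ 2 * P))
    (hZ : 0 ≤ Z) (hZ₃ : 0 ≤ Z₃) (hZ₄ : 0 ≤ Z₄) (hD : D ≤ A * (Z₃ * Z₄)) (hD' : -D' ≤ A * Z₄) :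
    c * ψ * y * Z + c * Ψ * D - P * y ^ 2 * (Z₃ * D') - y' * (P * y ^ 2) * Z ≤
      (κ ^ 2 + 1) * (1 + 2 * A) *
        (v * P * y * Z + (P * y ^ 2 + v ^ 2 * P) * (Z₃ * Z₄)) -
      (1 - c) * (P * y ^ 2 * y' * Z) := by
  have hPy : 0 ≤ P * y ^ 2 := by positivity
  have hPv : 0 ≤ v ^ 2 * P := by positivity
  have hκ : 0 ≤ κ ^ 2 := sq_nonneg κ
  have c1 : c * ψ * y * Z ≤ c * (P * y ^ 2 * y' * Z) + κ ^ 2 * (v * P * y * Z) := by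
    have h1 : c * ψ ≤ c * (P * y * y') + κ ^ 2 * (v * P) := by
      have h2 := mul_le_mul_of_nonneg_left hψ1 hc0
      have h3 : c * (κ ^ 2 * (v * P)) ≤ κ ^ 2 * (v * P) :=
        mul_le_of_le_one_left (by positivity) hc1.le
      linarith
    have := mul_le_mul_of_nonneg_right h1 (mul_nonneg hy hZ)
    linarith
  have c2 : c * Ψ * D ≤ (κ ^ 2 + 1) * A * ((P * y ^ 2 + v ^ 2 * P) * (Z₃ * Z₄)) := by
    have h1 : c * Ψ ≤ (κ ^ 2 + 1) * (P * y ^ 2 + v ^ 2 * P) := by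
      have h3 : c * Ψ ≤ Ψ := mul_le_of_le_one_left hΨ0 hc1.le
      nlinarith [mul_nonneg hκ hPy]
    calc c * Ψ * D ≤ c * Ψ * (A * (Z₃ * Z₄)) :=
          mul_le_mul_of_nonneg_left hD (mul_nonneg hc0 hΨ0)
      _ ≤ (κ ^ 2 + 1) * (P * y ^ 2 + v ^ 2 * P) * (A * (Z₃ * Z₄)) :=
          mul_le_mul_of_nonneg_right h1 (by positivity)
      _ = _ := by ring
  have c3 : -(P * y ^ 2 * (Z₃ * D')) ≤
      (κ ^ 2 + 1) * A * ((P * y ^ 2 + v ^ 2 * P) * (Z₃ * Z₄)) := by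
    calc -(P * y ^ 2 * (Z₃ * D')) = P * y ^ 2 * (Z₃ * -D') := by ring
      _ ≤ P * y ^ 2 * (Z₃ * (A * Z₄)) := by gcongr
      _ = P * y ^ 2 * (A * (Z₃ * Z₄)) := by ring
      _ ≤ ((κ ^ 2 + 1) * (P * y ^ 2 + v ^ 2 * P)) * (A * (Z₃ * Z₄)) := by
          refine mul_le_mul_of_nonneg_right ?_ (by positivity)
          nlinarith [mul_nonneg hκ hPy, mul_nonneg hκ hPv]
      _ = _ := by ring
  have p1 : 0 ≤ v * P * y * Z := by positivity
  have p2 : 0 ≤ (P * y ^ 2 + v ^ 2 * P) * (Z₃ * Z₄) := by positivity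
  nlinarith [mul_nonneg hκ p1, mul_nonneg hκ p2, mul_nonneg hA p1,
    mul_nonneg (mul_nonneg hκ hA) p1]

namespace IsNormalizedStable

variable {n : ℕ} {m θ κ : ℝ} {f f' f'' : ℝ → ℝ} {u : Euc n → ℝ}
  {u' : Euc n → Euc n →L[ℝ] ℝ} {u'' : Fin n → Euc n → Euc n →L[ℝ] ℝ}

lemma continuousOn_u (hc : IsNormalizedStable m θ κ f f' f'' u u' u'') :
    ContinuousOn u (ball 0 1) := hc.reg.1.continuousOn

lemma continuousOn_f (hc : IsNormalizedStable m θ κ f f' f'' u u' u'') :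
    ContinuousOn (fun x => f (u x)) (ball 0 1) := hc.continuousOn_comp hc.nl.continuousOn

lemma continuousOn_f' (hc : IsNormalizedStable m θ κ f f' f'' u u' u'') :
    ContinuousOn (fun x => f' (u x)) (ball 0 1) := hc.continuousOn_comp hc.nl.continuousOn'

lemma continuousOn_rpow (hc : IsNormalizedStable m θ κ f f' f'' u u' u'') {b : ℝ} (hb : 0 ≤ b) :
    ContinuousOn (fun x => f (u x) ^ b) (ball 0 1) :=
  hc.continuousOn_f.rpow_const fun _ _ => Or.inr hb

lemma integral_f_mul_bump_le (hc : IsNormalizedStable m θ κ f f' f'' u u' u'') :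
    ∫ x in ball (0 : Euc n) 1, f (u x) * bump (9 / 16) 4 x ≤ 8 * n + 48 := by
  have hU : IsOpen (ball (0 : Euc n) 1) := isOpen_ball
  have hK := isCompact_closedBall (0 : Euc n) (3 / 4)
  have hKU := closedBall_three_quarters_subset (n := n)
  have hη := hasC2On_bump (ball (0 : Euc n) 1) (9 / 16) 1
  have hb0 : ∀ k ≠ 0, ∀ x ∉ closedBall (0 : Euc n) (3 / 4), bump (9 / 16) k x = 0 :=
    fun k hk x hx => bump_eq_zero_of_notMem hk hx
  obtain ⟨i1, g1⟩ := integral_green hU hK hKU hη.1 hc.reg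
    (fun x hx => Or.inl (hb0 _ (by norm_num) x hx))
  obtain ⟨i2, g2⟩ := integral_green hU hK hKU hc.reg.1 hη
    (fun x hx => Or.inr fun i => by
      rw [bumpDeriv_stdVec, hb0 _ (by norm_num) x hx, mul_zero, zero_mul])
  have iR := hc.integrableOn.const_mul (8 * n + 48)
  have h := integral_add (i2.sub i1) iR
  have h' := integral_sub i2 i1
  simp only [Pi.sub_apply] at h
  rw [h', g1, g2, sub_zero, zero_add, integral_const_mul] at h
  have h3 : (8 * n + 48 : ℝ) * ∫ x in ball (0 : Euc n) 1, u x ≤ 8 * n + 48 :=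
    mul_le_of_le_one_right (by positivity) hc.integral_le
  refine le_trans ?_ h3
  rw [← h]
  refine setIntegral_mono_on (integrableOn_mul_bump hc.continuousOn_f (by norm_num))
    ((i2.sub i1).add iR) measurableSet_ball fun x hx => ?_
  have h1 := abs_sum_bumpDeriv₂_le (n := n) (k := 1) (ρ := 9 / 16) (by norm_num) x
  have h2 : bump (9 / 16) (1 + 1) x ≤ 1 := bump_le_one (by norm_num) x
  have h4 := (hc.mem x hx).1
  simp only [Finset.sum_add_distrib, ← Finset.mul_sum]
  rw [← hc.eqn x hx]
  have h5 : ∑ i, bumpDeriv (9 / 16) (1 + 1) x (stdVec i) * u' x (stdVec i) =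
      ∑ i, u' x (stdVec i) * bumpDeriv (9 / 16) (1 + 1) x (stdVec i) :=
    Finset.sum_congr rfl fun i _ => mul_comm _ _
  rw [h5]
  have h6 := (abs_le.1 h1).1
  norm_num at h6 h2 ⊢
  nlinarith [mul_le_mul_of_nonneg_left h2 (show (0 : ℝ) ≤ 8 * n + 48 by positivity)]

lemma exists_f_zero_le (n : ℕ) : ∃ C : ℝ, 0 < C ∧ ∀ (m θ κ : ℝ) (f f' f'' : ℝ → ℝ) (u : Euc n → ℝ)
    (u' : Euc n → Euc n →L[ℝ] ℝ) (u'' : Fin n → Euc n → Euc n →L[ℝ] ℝ),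
    IsNormalizedStable m θ κ f f' f'' u u' u'' → f 0 ≤ C := by
  have hp := integral_bump_pos (n := n) (k := 4) (by norm_num)
  refine ⟨(8 * n + 48) / ∫ x in ball (0 : Euc n) 1, bump (9 / 16) 4 x, by positivity, ?_⟩
  intro m θ κ f f' f'' u u' u'' hc
  rw [le_div_iff₀ hp, ← integral_const_mul]
  refine le_trans ?_ hc.integral_f_mul_bump_le
  refine setIntegral_mono_on (integrableOn_mul_bump continuousOn_const (by norm_num))
    (integrableOn_mul_bump hc.continuousOn_f (by norm_num)) measurableSet_ball fun x hx => ?_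
  exact mul_le_mul_of_nonneg_right
    (hc.nl.monotone le_rfl (hc.mem x hx).1 (hc.mem x hx).2) (bump_nonneg x)

/-- The Crandall–Rabinowitz estimate. -/
lemma exists_integral_deriv_le (n : ℕ) {b θ κ : ℝ} (hb : 2 < b)
    (hbθ : (b / 2 + 1) ^ 2 < b + 2 + θ) : ∃ C : ℝ, 0 < C ∧
    ∀ (m : ℝ) (f f' f'' : ℝ → ℝ) (u : Euc n → ℝ)
      (u' : Euc n → Euc n →L[ℝ] ℝ) (u'' : Fin n → Euc n → Euc n →L[ℝ] ℝ),
      IsNormalizedStable m θ κ f f' f'' u u' u'' →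
      ∫ x in ball (0 : Euc n) 1, f (u x) ^ b * f (u x) ^ 2 * f' (u x) * bump (9 / 16) 64 x ≤
        C * ∫ x in ball (0 : Euc n) 1, (u x * f (u x) ^ b * f (u x) * bump (9 / 16) 64 x +
          (f (u x) ^ b * f (u x) ^ 2 + u x ^ 2 * f (u x) ^ b) * bump (9 / 16) 62 x) := by
  have hb0 : 0 < b := by linarith
  have hθ : 0 < b + 2 + θ := lt_of_le_of_lt (sq_nonneg _) hbθ
  set c := (b / 2 + 1) ^ 2 / (b + 2 + θ) with hcdef
  have hc1 : c < 1 := (div_lt_one hθ).2 hbθ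
  have hc0 : 0 ≤ c := by positivity
  have hcb : (b / 2 + 1) ^ 2 = c * (b + 2 + θ) := by rw [hcdef]; field_simp
  have h1c : 0 < 1 - c := by linarith
  set A : ℝ := 2 * 64 * n + 4 * 64 * 63 with hA
  have hA0 : 0 < A := by positivity
  refine ⟨(1 - c)⁻¹ * ((κ ^ 2 + 1) * (1 + 2 * A)), by positivity, ?_⟩
  intro m f f' f'' u u' u'' hc
  obtain ⟨ψ, ψ', Ψ, hψ'c, hψ, hΨ, hψle⟩ := hc.nl.exists_test_functions hb
  have hsq : ∀ t ∈ Icc 0 m, (f t ^ (b / 2)) ^ 2 = f t ^ b := fun t ht => by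
    rw [← Real.rpow_natCast, ← Real.rpow_mul (hc.nl.nonneg t ht)]; norm_num
  have hφ2 : ∀ t ∈ Icc 0 m, (f t ^ (b / 2 + 1)) ^ 2 = f t ^ b * f t ^ 2 := fun t ht => by
    rw [Real.rpow_add_one' (hc.nl.nonneg t ht) (by linarith), mul_pow, hsq t ht]
  obtain ⟨iK, key⟩ := hc.integral_stability_nonneg (φ := fun t => f t ^ (b / 2 + 1))
    (φ' := fun t => f' t * (b / 2 + 1) * f t ^ (b / 2)) (ψ := fun t => c * ψ t)
    (ψ' := fun t => c * ψ' t) (Ψ := fun t => c * Ψ t)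
    (fun t ht => by
      have := (hc.nl.deriv t ht).rpow_const (p := b / 2 + 1) (Or.inr (by linarith))
      rwa [add_sub_cancel_right] at this)
    ((hc.nl.continuousOn'.mul continuousOn_const).mul
      (hc.nl.continuousOn.rpow_const fun _ _ => Or.inr (by positivity)))
    (fun t ht => (hψ t ht).const_mul c) (hψ'c.const_smul c)
    (fun t ht => (hΨ t ht).const_mul c) (fun t ht => by
      have := mul_le_mul_of_nonneg_left (hψle t ht).1 hc0
      rw [mul_pow, mul_pow, hsq t ht, hcb]
      linarith)
  have hψc : ContinuousOn ψ (Icc 0 m) := fun t ht => (hψ t ht).continuousWithinAt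
  have hΨc : ContinuousOn Ψ (Icc 0 m) := fun t ht => (hΨ t ht).continuousWithinAt
  have hfb := hc.continuousOn_rpow hb0.le
  have hf := hc.continuousOn_f
  have iL := integrableOn_mul_bump (k := 64) ((hfb.mul (hf.pow 2)).mul hc.continuousOn_f')
    (by norm_num)
  have iR := (integrableOn_mul_bump (k := 64) ((hc.continuousOn_u.mul hfb).mul hf)
    (by norm_num)).add (integrableOn_mul_bump (k := 62)
    ((hfb.mul (hf.pow 2)).add ((hc.continuousOn_u.pow 2).mul hfb)) (by norm_num))
  have iT := ((iR.const_mul ((κ ^ 2 + 1) * (1 + 2 * A))).sub (iL.const_mul (1 - c)))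
  rw [mul_assoc, ← div_eq_inv_mul, le_div_iff₀' h1c, ← integral_const_mul, ← integral_const_mul,
    ← sub_nonneg]
  have hsub := integral_sub (iR.const_mul ((κ ^ 2 + 1) * (1 + 2 * A))) (iL.const_mul (1 - c))
  simp only [Pi.add_apply, Pi.pow_apply, Pi.mul_apply] at hsub iT
  rw [← hsub]
  refine key.trans (setIntegral_mono_on iK iT measurableSet_ball fun x hx => ?_)
  have hu := hc.mem x hx
  have h0 := hc.nl.nonneg _ hu
  have h0' := hc.nl.nonneg' _ hu
  have hb0' : 0 ≤ f (u x) ^ b := Real.rpow_nonneg h0 b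
  obtain ⟨-, hψ1, hΨ0, hΨ1⟩ := hψle _ hu
  have a1 := abs_sum_bumpDeriv₂_le (n := n) (k := 61) (ρ := 9 / 16) (by norm_num) x
  have a2 := abs_sum_bumpDeriv₂_le (n := n) (k := 29) (ρ := 9 / 16) (by norm_num) x
  have hz : bump (9 / 16) 62 x = bump (9 / 16) 32 x * bump (9 / 16) 30 x :=
    bump_add (9 / 16) 32 30 x
  have z64 : 0 ≤ bump (9 / 16) 64 x := bump_nonneg x
  have z32 : 0 ≤ bump (9 / 16) 32 x := bump_nonneg x
  have z30 : 0 ≤ bump (9 / 16) 30 x := bump_nonneg x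
  rw [hφ2 _ hu]
  norm_num at a1 a2
  generalize bump (9 / 16) 64 x = Z at *
  generalize bump (9 / 16) 62 x = Z₂ at *
  generalize bump (9 / 16) 32 x = Z₃ at *
  generalize bump (9 / 16) 30 x = Z₄ at *
  subst hz
  have h3 : (0 : ℝ) ≤ n * Z₄ := by positivity
  have b1 := (abs_le.1 a1).2
  have b2 := (abs_le.1 a2).1
  exact stability_terms_le hb0' h0 hu.1 hc0 hc1 hA0.le hΨ0 hψ1 hΨ1 z64 z32 z30
    (by rw [hA]; linarith) (by rw [hA]; linarith)

end IsNormalizedStable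

lemma exists_young_le {b B : ℝ} (hb : 2 < b) (hb' : b ≤ 11 / 5) (hB : 1 ≤ B) :
    ∃ C : ℝ, 0 < C ∧ ∀ y S z : ℝ, 0 ≤ y → 1 ≤ S → 0 ≤ z → z ≤ 1 →
      B * (S * y ^ b * y ^ 2 * z ^ 62 + S ^ 2 * y ^ b * y * z ^ 48 + S ^ 3 * y ^ b * z ^ 30) ≤
        1 / 2 * (y ^ b * y ^ 3 * z ^ 80) + C * (S ^ (b + 2) * (y * z ^ 4)) := by
  refine ⟨3 * B * (6 * B) ^ (b + 1), by positivity, ?_⟩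
  intro y S z hy hS hz hz1
  rcases hz.eq_or_lt with rfl | hz0
  · simp
  have hS0 : 0 < S := by linarith
  set Q := S / z ^ 18 with hQdef
  have hQ0 : 0 < Q := by positivity
  have hSQ : S = Q * z ^ 18 := by rw [hQdef]; field_simp
  have hyb : 0 ≤ y ^ b := Real.rpow_nonneg hy b
  have hW : S * y ^ b * y ^ 2 * z ^ 62 + S ^ 2 * y ^ b * y * z ^ 48 + S ^ 3 * y ^ b * z ^ 30 ≤
      y ^ b * (Q * y ^ 2 + Q ^ 2 * y + Q ^ 3) * z ^ 80 := by
    have e1 : S * y ^ b * y ^ 2 * z ^ 62 = y ^ b * (Q * y ^ 2) * z ^ 80 := by rw [hSQ]; ring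
    have e2 : S ^ 2 * y ^ b * y * z ^ 48 = y ^ b * (Q ^ 2 * y) * z ^ 80 * z ^ 4 := by
      rw [hSQ]; ring
    have e3 : S ^ 3 * y ^ b * z ^ 30 = y ^ b * Q ^ 3 * z ^ 80 * z ^ 4 := by rw [hSQ]; ring
    have hz4 : z ^ 4 ≤ 1 := pow_le_one₀ hz hz1
    have l2 : y ^ b * (Q ^ 2 * y) * z ^ 80 * z ^ 4 ≤ y ^ b * (Q ^ 2 * y) * z ^ 80 :=
      mul_le_of_le_one_right (by positivity) hz4
    have l3 : y ^ b * Q ^ 3 * z ^ 80 * z ^ 4 ≤ y ^ b * Q ^ 3 * z ^ 80 :=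
      mul_le_of_le_one_right (by positivity) hz4
    rw [e1, e2, e3]
    linarith
  have hB0 : 0 < B := by linarith
  have hSp : 0 ≤ S ^ (b + 2) := by positivity
  have hBp : 0 ≤ (6 * B) ^ (b + 1) := by positivity
  refine (mul_le_mul_of_nonneg_left hW hB0.le).trans ?_
  rcases le_total (6 * B * Q) y with h | h
  · have hQy : Q ≤ y := by nlinarith
    have h1 : B * (Q * y ^ 2 + Q ^ 2 * y + Q ^ 3) ≤ 1 / 2 * y ^ 3 := by
      have h2 : Q ^ 2 * y ≤ Q * y ^ 2 := by
        nlinarith [mul_nonneg (mul_nonneg hQ0.le hy) (sub_nonneg.2 hQy)]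
      have h3 : Q ^ 3 ≤ Q * y ^ 2 := by
        have := pow_le_pow_left₀ hQ0.le hQy 2
        nlinarith
      have h4 := mul_le_mul_of_nonneg_right h (sq_nonneg y)
      nlinarith
    have h5 : 0 ≤ y ^ b * z ^ 80 := by positivity
    have h6 := mul_le_mul_of_nonneg_left h1 h5
    have h7 : 0 ≤ 3 * B * (6 * B) ^ (b + 1) * (S ^ (b + 2) * (y * z ^ 4)) := by positivity
    linarith
  · have hybQ : y ^ b ≤ (6 * B * Q) ^ (b - 1) * y := by
      rw [show b = b - 1 + 1 by ring, Real.rpow_add_one' hy (by linarith), sub_add_cancel]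
      exact mul_le_mul_of_nonneg_right (Real.rpow_le_rpow hy h (by linarith)) hy
    have hq : Q * y ^ 2 + Q ^ 2 * y + Q ^ 3 ≤ 3 * (6 * B) ^ 2 * Q ^ 3 := by
      have h6B : 1 ≤ 6 * B := by linarith
      have h2 : y ^ 2 ≤ (6 * B * Q) ^ 2 := pow_le_pow_left₀ hy h 2
      have h3 : (6 * B) ≤ (6 * B) ^ 2 := by nlinarith
      have h4 : Q * y ^ 2 ≤ (6 * B) ^ 2 * Q ^ 3 := by
        calc Q * y ^ 2 ≤ Q * (6 * B * Q) ^ 2 := by gcongr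
          _ = _ := by ring
      have h5 : Q ^ 2 * y ≤ (6 * B) ^ 2 * Q ^ 3 := by
        calc Q ^ 2 * y ≤ Q ^ 2 * (6 * B * Q) := by gcongr
          _ = 6 * B * Q ^ 3 := by ring
          _ ≤ _ := by gcongr
      have h6 : Q ^ 3 ≤ (6 * B) ^ 2 * Q ^ 3 := le_mul_of_one_le_left (by positivity) (by linarith)
      linarith
    have hQz : Q ^ (b + 2) * z ^ 80 ≤ S ^ (b + 2) * z ^ 4 := by
      have e1 : Q ^ (b + 2) * (z ^ 18) ^ (b + 2) = S ^ (b + 2) := by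
        rw [← Real.mul_rpow hQ0.le (by positivity), ← hSQ]
      have e2 : z ^ 76 ≤ (z ^ 18) ^ (b + 2) := by
        rw [← Real.rpow_natCast, ← Real.rpow_natCast, ← Real.rpow_mul hz]
        exact Real.rpow_le_rpow_of_exponent_ge hz0 hz1 (by push_cast; linarith)
      calc Q ^ (b + 2) * z ^ 80 = Q ^ (b + 2) * z ^ 76 * z ^ 4 := by ring
        _ ≤ Q ^ (b + 2) * (z ^ 18) ^ (b + 2) * z ^ 4 := by gcongr
        _ = _ := by rw [e1]
    have hp : (6 * B * Q) ^ (b - 1) * ((6 * B) ^ 2 * Q ^ 3) =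
        (6 * B) ^ (b + 1) * Q ^ (b + 2) := by
      rw [Real.mul_rpow (by positivity) hQ0.le, show b + 1 = b - 1 + (2 : ℕ) by push_cast; ring,
        show b + 2 = b - 1 + (3 : ℕ) by push_cast; ring, Real.rpow_add_natCast (by positivity),
        Real.rpow_add_natCast hQ0.ne']
      ring
    calc B * (y ^ b * (Q * y ^ 2 + Q ^ 2 * y + Q ^ 3) * z ^ 80)
        ≤ B * (((6 * B * Q) ^ (b - 1) * y) * (3 * (6 * B) ^ 2 * Q ^ 3) * z ^ 80) := by gcongr
      _ = 3 * B * y * z ^ 80 * ((6 * B * Q) ^ (b - 1) * ((6 * B) ^ 2 * Q ^ 3)) := by ring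
      _ = 3 * B * (6 * B) ^ (b + 1) * y * (Q ^ (b + 2) * z ^ 80) := by rw [hp]; ring
      _ ≤ 3 * B * (6 * B) ^ (b + 1) * y * (S ^ (b + 2) * z ^ 4) := by gcongr
      _ = 3 * B * (6 * B) ^ (b + 1) * (S ^ (b + 2) * (y * z ^ 4)) := by ring
      _ ≤ _ := le_add_of_nonneg_left (by positivity)

lemma bump_eq_pow {n : ℕ} (ρ : ℝ) (k : ℕ) (x : Euc n) : bump ρ k x = bump ρ 1 x ^ k := by
  simp [bump]

lemma higher_terms_le {P y y' v S z κ C₀ : ℝ} (hP : 0 ≤ P) (hy : 0 ≤ y) (hy' : 0 ≤ y') (hv : 0 ≤ v)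
    (hS : 1 ≤ S) (hz : 0 ≤ z) (hz1 : z ≤ 1) (hκ : 0 ≤ κ) (hC₀ : 0 ≤ C₀) (hvS : v * z ^ 16 ≤ S)
    (hle : y ≤ C₀ + v * (y' + κ)) :
    S * (v * P * y * z ^ 64 + (P * y ^ 2 + v ^ 2 * P) * z ^ 62) ≤
      S * P * y ^ 2 * z ^ 62 + S ^ 2 * P * y * z ^ 48 + S ^ 3 * P * z ^ 30 ∧
    P * y ^ 2 * z ^ 80 ≤
      S * P * y ^ 2 * z ^ 62 + S ^ 2 * P * y * z ^ 48 + S ^ 3 * P * z ^ 30 ∧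
    P * y ^ 3 * z ^ 80 ≤ (C₀ + κ) *
      (S * P * y ^ 2 * z ^ 62 + S ^ 2 * P * y * z ^ 48 + S ^ 3 * P * z ^ 30) +
        S * (P * y ^ 2 * y' * z ^ 64) := by
  have hS0 : 0 ≤ S := by linarith
  have t1 : 0 ≤ S * P * y ^ 2 * z ^ 62 := by positivity
  have t2 : 0 ≤ S ^ 2 * P * y * z ^ 48 := by positivity
  have t3 : 0 ≤ S ^ 3 * P * z ^ 30 := by positivity
  have hz2 : z ^ 2 ≤ 1 := pow_le_one₀ hz hz1
  have hz18 : z ^ 18 ≤ 1 := pow_le_one₀ hz hz1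
  have a1 : P * y ^ 2 * z ^ 80 ≤ S * P * y ^ 2 * z ^ 62 := by
    calc P * y ^ 2 * z ^ 80 = 1 * P * y ^ 2 * z ^ 62 * z ^ 18 := by ring
      _ ≤ S * P * y ^ 2 * z ^ 62 * 1 := by gcongr
      _ = _ := by ring
  have a2 : v * (P * y ^ 2 * z ^ 80) ≤ S * P * y ^ 2 * z ^ 62 := by
    calc v * (P * y ^ 2 * z ^ 80) = (v * z ^ 16) * P * y ^ 2 * z ^ 62 * z ^ 2 := by ring
      _ ≤ S * P * y ^ 2 * z ^ 62 * 1 := by gcongr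
      _ = _ := by ring
  refine ⟨?_, by linarith, ?_⟩
  · have b1 : S * (v * P * y * z ^ 64) ≤ S ^ 2 * P * y * z ^ 48 := by
      calc S * (v * P * y * z ^ 64) = S * P * y * z ^ 48 * (v * z ^ 16) := by ring
        _ ≤ S * P * y * z ^ 48 * S := by gcongr
        _ = _ := by ring
    have b2 : S * (v ^ 2 * P * z ^ 62) ≤ S ^ 3 * P * z ^ 30 := by
      calc S * (v ^ 2 * P * z ^ 62) = S * P * z ^ 30 * (v * z ^ 16) ^ 2 := by ring
        _ ≤ S * P * z ^ 30 * S ^ 2 := by gcongr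
        _ = _ := by ring
    linarith
  · have c1 : v * (P * y ^ 2 * y' * z ^ 80) ≤ S * (P * y ^ 2 * y' * z ^ 64) := by
      calc v * (P * y ^ 2 * y' * z ^ 80) = P * y ^ 2 * y' * z ^ 64 * (v * z ^ 16) := by ring
        _ ≤ P * y ^ 2 * y' * z ^ 64 * S := by gcongr
        _ = _ := by ring
    have c2 : P * y ^ 3 * z ^ 80 ≤ P * y ^ 2 * z ^ 80 * (C₀ + v * (y' + κ)) := by
      calc P * y ^ 3 * z ^ 80 = P * y ^ 2 * z ^ 80 * y := by ring
        _ ≤ _ := by gcongr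
    have c3 := mul_le_mul_of_nonneg_left a1 hC₀
    have c4 := mul_le_mul_of_nonneg_left a2 hκ
    nlinarith [mul_nonneg hC₀ t2, mul_nonneg hC₀ t3, mul_nonneg hκ t2, mul_nonneg hκ t3]

namespace IsNormalizedStable

lemma exists_integral_rpow_le (n : ℕ) {b θ κ : ℝ} (hb : 2 < b) (hb' : b ≤ 11 / 5)
    (hbθ : (b / 2 + 1) ^ 2 < b + 2 + θ) : ∃ C : ℝ, 0 < C ∧
    ∀ (m : ℝ) (f f' f'' : ℝ → ℝ) (u : Euc n → ℝ)
      (u' : Euc n → Euc n →L[ℝ] ℝ) (u'' : Fin n → Euc n → Euc n →L[ℝ] ℝ) (S : ℝ),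
      IsNormalizedStable m θ κ f f' f'' u u' u'' → 1 ≤ S →
      (∀ x ∈ ball (0 : Euc n) 1, u x * bump (9 / 16) 16 x ≤ S) →
      ∫ x in ball (0 : Euc n) 1, f (u x) ^ b * f (u x) ^ 3 * bump (9 / 16) 80 x ≤
        C * S ^ (b + 2) ∧
      ∫ x in ball (0 : Euc n) 1, f (u x) ^ b * f (u x) ^ 2 * bump (9 / 16) 80 x ≤
        C * S ^ (b + 2) ∧
      ∫ x in ball (0 : Euc n) 1, f (u x) ^ b * f (u x) ^ 2 * f' (u x) * bump (9 / 16) 64 x ≤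
        C * S ^ (b + 2) := by
  obtain ⟨C₀, hC₀, h₀⟩ := exists_f_zero_le n
  obtain ⟨C₁, hC₁, h₁⟩ := exists_integral_deriv_le n (κ := κ) hb hbθ
  set B := C₀ + κ ^ 2 + C₁ + 1 with hB
  have hκ2 := sq_nonneg κ
  have hB1 : 1 ≤ B := by linarith
  obtain ⟨C₂, hC₂, h₂⟩ := exists_young_le hb hb' hB1
  refine ⟨2 * C₂ * (8 * n + 48), by positivity, ?_⟩
  intro m f f' f'' u u' u'' S hc hS hSu
  have hf0 := h₀ m θ κ f f' f'' u u' u'' hc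
  have hCR := h₁ m f f' f'' u u' u'' hc
  have hκ1 := hc.nl.one_le
  have hS0 : 0 < S := by linarith
  have hfb := hc.continuousOn_rpow (b := b) (by linarith)
  have hf := hc.continuousOn_f
  have hu := hc.continuousOn_u
  have hcS : ∀ k : ℕ, ContinuousOn (fun _ : Euc n => S ^ k) (ball 0 1) :=
    fun k => continuousOn_const
  have iI := integrableOn_mul_bump (k := 80) (hfb.mul (hf.pow 3)) (by norm_num)
  have iJ := integrableOn_mul_bump (k := 80) (hfb.mul (hf.pow 2)) (by norm_num)
  have iL := integrableOn_mul_bump (k := 64) ((hfb.mul (hf.pow 2)).mul hc.continuousOn_f')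
    (by norm_num)
  have iR := (integrableOn_mul_bump (k := 64) ((hu.mul hfb).mul hf)
    (by norm_num)).add (integrableOn_mul_bump (k := 62)
    ((hfb.mul (hf.pow 2)).add ((hu.pow 2).mul hfb)) (by norm_num))
  have iW := ((integrableOn_mul_bump (k := 62) (((continuousOn_const (c := S)).mul hfb).mul
    (hf.pow 2)) (by norm_num)).add (integrableOn_mul_bump (k := 48) (((hcS 2).mul hfb).mul hf)
    (by norm_num))).add (integrableOn_mul_bump (k := 30) ((hcS 3).mul hfb) (by norm_num))
  have iF := integrableOn_mul_bump (k := 4) hf (by norm_num)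
  have hF := hc.integral_f_mul_bump_le
  simp only [Pi.add_apply, Pi.pow_apply, Pi.mul_apply] at iI iJ iL iR iW iF
  set W : Euc n → ℝ := fun x => S * f (u x) ^ b * f (u x) ^ 2 * bump (9 / 16) 62 x +
    S ^ 2 * f (u x) ^ b * f (u x) * bump (9 / 16) 48 x +
    S ^ 3 * f (u x) ^ b * bump (9 / 16) 30 x with hWdef
  have iW' : IntegrableOn W (ball 0 1) := iW
  have hpt : ∀ x ∈ ball (0 : Euc n) 1,
      S * (u x * f (u x) ^ b * f (u x) * bump (9 / 16) 64 x +
          (f (u x) ^ b * f (u x) ^ 2 + u x ^ 2 * f (u x) ^ b) * bump (9 / 16) 62 x) ≤ W x ∧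
      f (u x) ^ b * f (u x) ^ 2 * bump (9 / 16) 80 x ≤ W x ∧
      f (u x) ^ b * f (u x) ^ 3 * bump (9 / 16) 80 x ≤ (C₀ + κ) * W x +
        S * (f (u x) ^ b * f (u x) ^ 2 * f' (u x) * bump (9 / 16) 64 x) := fun x hx => by
    have hm := hc.mem x hx
    have hle := hc.nl.le_add_mul hm
    have hSx := hSu x hx
    have hz : 0 ≤ bump (9 / 16) 1 x := bump_nonneg x
    have hz1 : bump (9 / 16) 1 x ≤ 1 := bump_le_one (by norm_num) x
    rw [bump_eq_pow] at hSx
    simp only [hWdef, bump_eq_pow (9 / 16) 64 x, bump_eq_pow (9 / 16) 62 x,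
      bump_eq_pow (9 / 16) 80 x, bump_eq_pow (9 / 16) 48 x, bump_eq_pow (9 / 16) 30 x]
    exact higher_terms_le (Real.rpow_nonneg (hc.nl.nonneg _ hm) b) (hc.nl.nonneg _ hm)
      (hc.nl.nonneg' _ hm) hm.1 hS hz hz1 (by linarith) hC₀.le hSx (by linarith)
  have hW0 : 0 ≤ ∫ x in ball (0 : Euc n) 1, W x :=
    setIntegral_nonneg measurableSet_ball fun x hx => by
      have h0 := hc.nl.nonneg _ (hc.mem x hx)
      have := (hpt x hx).2.1
      exact le_trans (mul_nonneg (mul_nonneg (Real.rpow_nonneg h0 b) (sq_nonneg _))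
        (bump_nonneg x)) this
  have e1 := setIntegral_mono_on (iR.const_mul S) iW' measurableSet_ball fun x hx => (hpt x hx).1
  have e2 := setIntegral_mono_on iJ iW' measurableSet_ball fun x hx => (hpt x hx).2.1
  have e3 := setIntegral_mono_on iI ((iW'.const_mul (C₀ + κ)).add (iL.const_mul S))
    measurableSet_ball fun x hx => (hpt x hx).2.2
  have e4 := setIntegral_mono_on (iW'.const_mul B)
    ((iI.const_mul (1 / 2)).add ((iF.const_mul (S ^ (b + 2))).const_mul C₂))
    measurableSet_ball fun x hx => by
      have hz : 0 ≤ bump (9 / 16) 1 x := bump_nonneg x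
      have hz1 : bump (9 / 16) 1 x ≤ 1 := bump_le_one (by norm_num) x
      simp only [hWdef, Pi.add_apply, bump_eq_pow (9 / 16) 62 x, bump_eq_pow (9 / 16) 4 x,
        bump_eq_pow (9 / 16) 80 x, bump_eq_pow (9 / 16) 48 x, bump_eq_pow (9 / 16) 30 x]
      exact h₂ (f (u x)) S _ (hc.nl.nonneg _ (hc.mem x hx)) hS hz hz1
  have e3' := integral_add (iW'.const_mul (C₀ + κ)) (iL.const_mul S)
  have e4' := integral_add (iI.const_mul (1 / 2)) ((iF.const_mul (S ^ (b + 2))).const_mul C₂)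
  simp only [Pi.add_apply] at e3 e4
  rw [e3'] at e3
  rw [e4'] at e4
  simp only [integral_const_mul] at e1 e3 e4
  have hSp : 0 ≤ S ^ (b + 2) := by positivity
  have hF' := mul_le_mul_of_nonneg_left hF (mul_nonneg hC₂.le hSp)
  generalize (∫ x in ball (0 : Euc n) 1, W x) = IW at *
  generalize (∫ x in ball (0 : Euc n) 1, f (u x) * bump (9 / 16) 4 x) = IF at *
  generalize (∫ x in ball (0 : Euc n) 1, f (u x) ^ b * f (u x) ^ 3 * bump (9 / 16) 80 x) = II at *
  generalize (∫ x in ball (0 : Euc n) 1, f (u x) ^ b * f (u x) ^ 2 * bump (9 / 16) 80 x) = IJ at *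
  generalize (∫ x in ball (0 : Euc n) 1,
    f (u x) ^ b * f (u x) ^ 2 * f' (u x) * bump (9 / 16) 64 x) = IL at *
  generalize (∫ x in ball (0 : Euc n) 1, (u x * f (u x) ^ b * f (u x) * bump (9 / 16) 64 x +
    (f (u x) ^ b * f (u x) ^ 2 + u x ^ 2 * f (u x) ^ b) * bump (9 / 16) 62 x)) = IR at *
  have g1 : S * IL ≤ C₁ * IW := by
    calc S * IL ≤ S * (C₁ * IR) := by gcongr
      _ = C₁ * (S * IR) := by ring
      _ ≤ C₁ * IW := by gcongr
  have g2 : II ≤ B * IW := by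
    have : κ * IW ≤ κ ^ 2 * IW := by
      refine mul_le_mul_of_nonneg_right ?_ hW0
      nlinarith
    rw [hB]; nlinarith
  have g3 : B * IW ≤ 2 * C₂ * (8 * n + 48) * S ^ (b + 2) := by linarith
  refine ⟨g2.trans g3, ?_, ?_⟩
  · have : IW ≤ B * IW := le_mul_of_one_le_left hW0 hB1
    linarith
  · refine le_trans ?_ g3
    have k1 : 0 ≤ C₁ * IW := by positivity
    have k2 : IL ≤ C₁ * IW := by
      by_contra! hlt
      nlinarith
    have k3 : C₁ * IW ≤ B * IW := mul_le_mul_of_nonneg_right (by linarith) hW0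
    linarith

end IsNormalizedStable

lemma bump_half_le {n : ℕ} {x₀ x : Euc n} (h₀ : 0 < bump (9 / 16) 1 x₀)
    (hx : x ∈ closedBall x₀ (bump (9 / 16) 1 x₀ / 4)) :
    bump (9 / 16) 1 x₀ / 2 ≤ bump (9 / 16) 1 x ∧ x ∈ ball (0 : Euc n) 1 := by
  have hz1 : bump (9 / 16) 1 x₀ ≤ 1 := bump_le_one (by norm_num) x₀
  have e₀ : bump (9 / 16) 1 x₀ = 9 / 16 - ‖x₀‖ ^ 2 := by
    simp only [bump, pow_one] at h₀ ⊢
    exact max_eq_right (lt_max_iff.1 h₀ |>.resolve_left (lt_irrefl _)).le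
  have e : 9 / 16 - ‖x‖ ^ 2 ≤ bump (9 / 16) 1 x := by
    simp only [bump, pow_one]
    exact le_max_right _ _
  have h1 : ‖x‖ ≤ ‖x₀‖ + bump (9 / 16) 1 x₀ / 4 := by
    have := norm_le_norm_add_norm_sub' x x₀
    rw [mem_closedBall, dist_eq_norm] at hx
    linarith
  have hn0 := norm_nonneg x₀
  have hn := norm_nonneg x
  generalize bump (9 / 16) 1 x₀ = z at *
  have h34 : ‖x₀‖ ≤ 3 / 4 := by nlinarith
  have h2 : ‖x‖ ^ 2 ≤ (‖x₀‖ + z / 4) ^ 2 := pow_le_pow_left₀ hn h1 2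
  exact ⟨by nlinarith, by rw [mem_ball_zero_iff]; nlinarith⟩

/-- The local sup bound in weighted form. -/
lemma exists_weighted_sup_bound {n : ℕ} (hn6 : n ≤ 6) {q : ℝ} (hq : 3 < q) {N k j : ℕ}
    (hjk : j + 6 ≤ k) (hkN : k ≤ N) (hNq : (N : ℝ) ≤ k * q) : ∃ C : ℝ, 0 < C ∧
    ∀ (w : Euc n → ℝ) (w' : Euc n → Euc n →L[ℝ] ℝ) (w'' : Fin n → Euc n → Euc n →L[ℝ] ℝ)
      (g : Euc n → ℝ) (W G : ℝ), HasC2On (ball 0 1) w w' w'' →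
      (∀ x ∈ ball (0 : Euc n) 1, 0 ≤ w x) → (∀ x ∈ ball (0 : Euc n) 1, 0 ≤ g x) →
      ContinuousOn g (ball 0 1) →
      (∀ x ∈ ball (0 : Euc n) 1, -∑ i, w'' i x (stdVec i) ≤ g x) →
      IntegrableOn (fun x => w x * bump (9 / 16) j x) (ball 0 1) →
      ∫ x in ball (0 : Euc n) 1, w x * bump (9 / 16) j x ≤ W →
      ∫ x in ball (0 : Euc n) 1, g x ^ q * bump (9 / 16) N x ≤ G →
      ∀ x ∈ ball (0 : Euc n) 1, ∀ Λ : ℝ, 0 < Λ →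
        w x * bump (9 / 16) k x ≤ C * (W + Λ * G + Λ ^ (-1 / (q - 1))) := by
  obtain ⟨C, hC, hsup⟩ := exists_sup_bound n hn6 hq
  refine ⟨C * (4 ^ 6 * 2 ^ j + 2 ^ N + 1), by positivity, ?_⟩
  intro w w' w'' g W G hw hw0 hg0 hgc hle iW hW hG x₀ hx₀ Λ hΛ
  have hgq : ContinuousOn (fun x => g x ^ q) (ball 0 1) :=
    hgc.rpow_const fun _ _ => Or.inr (by linarith)
  have iG := integrableOn_mul_bump (k := N) hgq (by omega)
  have hgq0 : ∀ x ∈ ball (0 : Euc n) 1, 0 ≤ g x ^ q := fun x hx => Real.rpow_nonneg (hg0 x hx) q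
  have hW0 : 0 ≤ W := le_trans (setIntegral_nonneg measurableSet_ball fun x hx =>
    mul_nonneg (hw0 x hx) (bump_nonneg x)) hW
  have hG0 : 0 ≤ G := le_trans (setIntegral_nonneg measurableSet_ball fun x hx =>
    mul_nonneg (hgq0 x hx) (bump_nonneg x)) hG
  have hΛq : 0 ≤ Λ ^ (-1 / (q - 1)) := Real.rpow_nonneg hΛ.le _
  rcases (bump_nonneg (ρ := 9 / 16) (k := 1) x₀).eq_or_lt with hz | hz
  · rw [bump_eq_pow, ← hz, zero_pow (by omega), mul_zero]
    positivity
  have hsub : closedBall x₀ (bump (9 / 16) 1 x₀ / 4) ⊆ ball (0 : Euc n) 1 :=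
    fun x hx => (bump_half_le hz hx).2
  have hball : ball x₀ (bump (9 / 16) 1 x₀ / 4) ⊆ ball (0 : Euc n) 1 :=
    ball_subset_closedBall.trans hsub
  have hz1 : bump (9 / 16) 1 x₀ ≤ 1 := bump_le_one (by norm_num) x₀
  have hloc : ∀ (h : Euc n → ℝ) (i : ℕ) (H : ℝ), ContinuousOn h (ball 0 1) →
      (∀ x ∈ ball (0 : Euc n) 1, 0 ≤ h x) →
      IntegrableOn (fun x => h x * bump (9 / 16) i x) (ball 0 1) →
      ∫ x in ball (0 : Euc n) 1, h x * bump (9 / 16) i x ≤ H →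
      bump (9 / 16) 1 x₀ ^ i * ∫ x in ball x₀ (bump (9 / 16) 1 x₀ / 4), h x ≤ 2 ^ i * H := by
    intro h i H hhc hh0 hi hH
    have h2 : ∫ x in ball x₀ (bump (9 / 16) 1 x₀ / 4), h x * bump (9 / 16) i x ≤
        ∫ x in ball (0 : Euc n) 1, h x * bump (9 / 16) i x :=
      setIntegral_mono_set hi ((ae_restrict_mem measurableSet_ball).mono fun x hx =>
        mul_nonneg (hh0 x hx) (bump_nonneg x)) hball.eventuallyLE
    have ih : IntegrableOn h (ball x₀ (bump (9 / 16) 1 x₀ / 4)) :=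
      ((hhc.mono hsub).integrableOn_compact (isCompact_closedBall _ _)).mono_set
        ball_subset_closedBall
    have h1 : (bump (9 / 16) 1 x₀ / 2) ^ i * ∫ x in ball x₀ (bump (9 / 16) 1 x₀ / 4), h x ≤
        ∫ x in ball x₀ (bump (9 / 16) 1 x₀ / 4), h x * bump (9 / 16) i x := by
      rw [← integral_const_mul]
      refine setIntegral_mono_on (ih.const_mul _) (hi.mono_set hball) measurableSet_ball
        fun x hx => ?_
      rw [mul_comm, bump_eq_pow (9 / 16) i x]
      exact mul_le_mul_of_nonneg_left (pow_le_pow_left₀ (by positivity)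
        (bump_half_le hz (ball_subset_closedBall hx)).1 i) (hh0 x (hball hx))
    rw [div_pow, div_mul_eq_mul_div, div_le_iff₀ (by positivity)] at h1
    nlinarith [pow_pos (two_pos (α := ℝ)) i]
  have l1 := hloc w j W hw.1.continuousOn hw0 iW hW
  have l2 := hloc (fun x => g x ^ q) N G hgq hgq0 iG hG
  rw [bump_eq_pow (9 / 16) k x₀]
  generalize bump (9 / 16) 1 x₀ = z at *
  have hμ : 0 < z ^ (N - k) * Λ := by positivity
  have key := hsup _ w w' w'' g x₀ (z / 4) _ isOpen_ball hw hw0 hg0 hgc hle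
    (by positivity) (by linarith) hsub hμ
  have hI1 : 0 ≤ ∫ x in ball x₀ (z / 4), w x :=
    setIntegral_nonneg measurableSet_ball fun x hx => hw0 x (hball hx)
  generalize (∫ x in ball x₀ (z / 4), w x) = I₁ at *
  generalize (∫ x in ball x₀ (z / 4), g x ^ q) = I₂ at *
  have t1 : z ^ k * (((z / 4) ^ 6)⁻¹ * I₁) ≤ 4 ^ 6 * 2 ^ j * W := by
    obtain ⟨l, rfl⟩ := Nat.exists_eq_add_of_le hjk
    have e : z ^ (j + 6 + l) * (((z / 4) ^ 6)⁻¹ * I₁) = 4 ^ 6 * (z ^ j * I₁) * z ^ l := by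
      field_simp; ring
    rw [e]
    calc 4 ^ 6 * (z ^ j * I₁) * z ^ l ≤ 4 ^ 6 * (2 ^ j * W) * 1 := by
          gcongr
          exact pow_le_one₀ hz.le hz1
      _ = _ := by ring
  have t2 : z ^ k * (z ^ (N - k) * Λ * I₂) ≤ 2 ^ N * (Λ * G) := by
    have e : z ^ k * (z ^ (N - k) * Λ * I₂) = Λ * (z ^ N * I₂) := by
      rw [← Nat.add_sub_of_le hkN, pow_add, Nat.add_sub_cancel_left]; ring
    rw [e]
    calc Λ * (z ^ N * I₂) ≤ Λ * (2 ^ N * G) := by gcongr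
      _ = _ := by ring
  have t3 : z ^ k * (z ^ (N - k) * Λ) ^ (-1 / (q - 1)) ≤ Λ ^ (-1 / (q - 1)) := by
    rw [Real.mul_rpow (by positivity) hΛ.le, ← mul_assoc]
    refine mul_le_of_le_one_left hΛq ?_
    rw [← Real.rpow_natCast, ← Real.rpow_natCast, ← Real.rpow_mul hz.le, ← Real.rpow_add hz]
    refine Real.rpow_le_one hz.le hz1 ?_
    rw [Nat.cast_sub hkN]
    have hq1 : 0 < q - 1 := by linarith
    have : (k : ℝ) + ((N : ℝ) - k) * (-1 / (q - 1)) = (k * q - N) / (q - 1) := by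
      field_simp; ring
    rw [this]
    exact div_nonneg (by linarith) hq1.le
  have hzk : 0 ≤ z ^ k := by positivity
  calc w x₀ * z ^ k ≤ C * (((z / 4) ^ 6)⁻¹ * I₁ + z ^ (N - k) * Λ * I₂ +
        (z ^ (N - k) * Λ) ^ (-1 / (q - 1))) * z ^ k := mul_le_mul_of_nonneg_right key hzk
    _ = C * (z ^ k * (((z / 4) ^ 6)⁻¹ * I₁) + z ^ k * (z ^ (N - k) * Λ * I₂) +
        z ^ k * (z ^ (N - k) * Λ) ^ (-1 / (q - 1))) := by ring
    _ ≤ C * (4 ^ 6 * 2 ^ j * W + 2 ^ N * (Λ * G) + Λ ^ (-1 / (q - 1))) := by gcongr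
    _ ≤ C * ((4 ^ 6 * 2 ^ j + 2 ^ N + 1) * (W + Λ * G + Λ ^ (-1 / (q - 1)))) := by
        refine mul_le_mul_of_nonneg_left ?_ hC.le
        have p1 : (0 : ℝ) ≤ 4 ^ 6 * 2 ^ j := by positivity
        have p2 : (0 : ℝ) ≤ 2 ^ N := by positivity
        have p3 : 0 ≤ Λ * G := by positivity
        nlinarith [mul_nonneg p1 p3, mul_nonneg p1 hΛq, mul_nonneg p2 hW0, mul_nonneg p2 hΛq]
    _ = _ := by ring

namespace IsNormalizedStable

lemma exists_max_mul_bump {n : ℕ} {w : Euc n → ℝ} (hw : ContinuousOn w (ball 0 1))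
    (hw0 : ∀ x ∈ ball (0 : Euc n) 1, 0 ≤ w x) {k : ℕ} (hk : k ≠ 0) :
    ∃ x₀ ∈ ball (0 : Euc n) 1, ∀ x ∈ ball (0 : Euc n) 1,
      w x * bump (9 / 16) k x ≤ w x₀ * bump (9 / 16) k x₀ := by
  obtain ⟨x₀, hx₀, hmax⟩ := (isCompact_closedBall (0 : Euc n) (3 / 4)).exists_isMaxOn
    ⟨0, mem_closedBall_self (by norm_num)⟩
    ((hw.mono closedBall_three_quarters_subset).mul
      (continuous_bump (ρ := 9 / 16) (k := k)).continuousOn)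
  refine ⟨x₀, closedBall_three_quarters_subset hx₀, fun x hx => ?_⟩
  by_cases hxK : x ∈ closedBall (0 : Euc n) (3 / 4)
  · exact hmax hxK
  · rw [bump_eq_zero_of_notMem hk hxK, mul_zero]
    exact mul_nonneg (hw0 _ (closedBall_three_quarters_subset hx₀)) (bump_nonneg x₀)

lemma exists_mul_bump_le {n : ℕ} (hn6 : n ≤ 6) {b θ κ : ℝ} (hb : 2 < b) (hb' : b ≤ 11 / 5)
    (hbθ : (b / 2 + 1) ^ 2 < b + 2 + θ) : ∃ C : ℝ, 1 ≤ C ∧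
    ∀ (m : ℝ) (f f' f'' : ℝ → ℝ) (u : Euc n → ℝ)
      (u' : Euc n → Euc n →L[ℝ] ℝ) (u'' : Fin n → Euc n → Euc n →L[ℝ] ℝ),
      IsNormalizedStable m θ κ f f' f'' u u' u'' →
      ∀ x ∈ ball (0 : Euc n) 1, u x * bump (9 / 16) 16 x ≤ C := by
  obtain ⟨C₁, hC₁, h₁⟩ := exists_integral_rpow_le n (κ := κ) hb hb' hbθ
  obtain ⟨C₂, hC₂, h₂⟩ := exists_weighted_sup_bound hn6 (q := b + 3) (by linarith) (N := 80)
    (k := 16) (j := 0) (by norm_num) (by norm_num) (by push_cast; linarith)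
  set L := (2 * C₂) ^ (b + 2)
  refine ⟨2 * (1 + C₂ * (1 + L * C₁)), by
    have : 0 ≤ C₂ * (1 + L * C₁) := by positivity
    linarith, ?_⟩
  intro m f f' f'' u u' u'' hc
  have hu0 : ∀ x ∈ ball (0 : Euc n) 1, 0 ≤ u x := fun x hx => (hc.mem x hx).1
  have hf0 : ∀ x ∈ ball (0 : Euc n) 1, 0 ≤ f (u x) := fun x hx => hc.nl.nonneg _ (hc.mem x hx)
  obtain ⟨x₀, hx₀, hmax⟩ := exists_max_mul_bump hc.continuousOn_u hu0 (k := 16) (by norm_num)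
  set M := u x₀ * bump (9 / 16) 16 x₀
  have hM : 0 ≤ M := mul_nonneg (hu0 x₀ hx₀) (bump_nonneg x₀)
  obtain ⟨hE, -, -⟩ := h₁ m f f' f'' u u' u'' (1 + M) hc (by linarith)
    fun x hx => (hmax x hx).trans (by linarith)
  have hS : 0 < 1 + M := by linarith
  have hE' : ∫ x in ball (0 : Euc n) 1, f (u x) ^ (b + 3) * bump (9 / 16) 80 x ≤
      C₁ * (1 + M) ^ (b + 2) := by
    refine le_trans (le_of_eq (setIntegral_congr_fun measurableSet_ball fun x hx => ?_)) hE
    have : f (u x) ^ (b + 3) = f (u x) ^ b * f (u x) ^ 3 := by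
      rw [← Real.rpow_natCast, ← Real.rpow_add_of_nonneg (hf0 x hx) (by linarith) (by norm_num)]
      norm_num
    simp only [this]
  have hb0 : ∀ x : Euc n, bump (9 / 16) 0 x = 1 := fun x => by simp [bump]
  have key := h₂ u u' u'' (fun x => f (u x)) 1 _ hc.reg hu0 hf0 hc.continuousOn_f
    (fun x hx => (hc.eqn x hx).le) (by simpa only [hb0, mul_one] using hc.integrableOn)
    (by simpa only [hb0, mul_one] using hc.integral_le) hE' x₀ hx₀
    (L / (1 + M) ^ (b + 2)) (by positivity)
  have e1 : L / (1 + M) ^ (b + 2) * (C₁ * (1 + M) ^ (b + 2)) = L * C₁ := by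
    have : (0 : ℝ) < (1 + M) ^ (b + 2) := by positivity
    field_simp
  have e2 : (L / (1 + M) ^ (b + 2)) ^ (-1 / (b + 3 - 1)) = (1 + M) / (2 * C₂) := by
    rw [← Real.div_rpow (by positivity) hS.le, ← Real.rpow_mul (by positivity),
      show (b + 2) * (-1 / (b + 3 - 1)) = -1 by
        rw [show b + 3 - 1 = b + 2 by ring]
        have : b + 2 ≠ 0 := by linarith
        field_simp, Real.rpow_neg_one, inv_div]
  rw [e1, e2] at key
  have e3 : C₂ * (1 + L * C₁ + (1 + M) / (2 * C₂)) = C₂ * (1 + L * C₁) + (1 + M) / 2 := by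
    field_simp
  rw [e3] at key
  intro x hx
  have := hmax x hx
  change M ≤ _ at key
  linarith

end IsNormalizedStable

namespace IsNormalizedStable

lemma exists_primitive_mul_bump_le {n : ℕ} (hn6 : n ≤ 6) {b θ κ : ℝ} (hb : 2 < b) (hb' : b ≤ 11 / 5)
    (hbθ : (b / 2 + 1) ^ 2 < b + 2 + θ) : ∃ C : ℝ, 0 < C ∧
    ∀ (m : ℝ) (f f' f'' : ℝ → ℝ) (u : Euc n → ℝ)
      (u' : Euc n → Euc n →L[ℝ] ℝ) (u'' : Fin n → Euc n → Euc n →L[ℝ] ℝ),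
      IsNormalizedStable m θ κ f f' f'' u u' u'' →
      ∀ x ∈ ball (0 : Euc n) 1, (∫ s in (0 : ℝ)..u x, f s) * bump (9 / 16) 40 x ≤ C := by
  obtain ⟨C₀, hC₀, h₀⟩ := exists_f_zero_le n
  obtain ⟨Cu, hCu, hu⟩ := exists_mul_bump_le hn6 (κ := κ) hb hb' hbθ
  obtain ⟨C₁, hC₁, h₁⟩ := exists_integral_rpow_le n (κ := κ) hb hb' hbθ
  obtain ⟨C₂, hC₂, h₂⟩ := exists_weighted_sup_bound hn6 (q := b / 2 + 2) (by linarith) (N := 120)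
    (k := 40) (j := 20) (by norm_num) (by norm_num) (by push_cast; linarith)
  have hCu0 : 0 < Cu := by linarith
  set C₃ := C₁ * Cu ^ (b + 2)
  have hC₃ : 0 < C₃ := by positivity
  set Λ := 1 / (4 * C₂ * C₃ * (1 + κ ^ 2)) with hΛdef
  have hΛ : 0 < Λ := by positivity
  refine ⟨2 * (C₂ * (Cu * (8 * n + 48) + Λ * (C₀ ^ 2 * C₃) + Λ ^ (-1 / (b / 2 + 2 - 1)))),
    by positivity, ?_⟩
  intro m f f' f'' u u' u'' hc
  have hu0 : ∀ x ∈ ball (0 : Euc n) 1, 0 ≤ u x := fun x hx => (hc.mem x hx).1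
  have hf0 : ∀ x ∈ ball (0 : Euc n) 1, 0 ≤ f (u x) := fun x hx => hc.nl.nonneg _ (hc.mem x hx)
  have hf0' : ∀ x ∈ ball (0 : Euc n) 1, 0 ≤ f' (u x) := fun x hx => hc.nl.nonneg' _ (hc.mem x hx)
  have hF := hasDerivWithinAt_primitive hc.nl.continuousOn
  have hreg := hc.reg.comp_real isOpen_ball hF hc.nl.deriv hc.nl.continuousOn' hc.mem
  have hF0 : ∀ x ∈ ball (0 : Euc n) 1, 0 ≤ ∫ s in (0 : ℝ)..u x, f s :=
    fun x hx => hc.nl.primitive_nonneg (hc.mem x hx)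
  have hFc := hreg.1.continuousOn
  have hux := hu m f f' f'' u u' u'' hc
  obtain ⟨-, hJ, hL⟩ := h₁ m f f' f'' u u' u'' Cu hc hCu hux
  obtain ⟨x₀, hx₀, hmax⟩ := exists_max_mul_bump hFc hF0 (k := 40) (by norm_num)
  set M := (∫ s in (0 : ℝ)..u x₀, f s) * bump (9 / 16) 40 x₀
  have hM : 0 ≤ M := mul_nonneg (hF0 x₀ hx₀) (bump_nonneg x₀)
  have hb1 : ∀ (k : ℕ) (x : Euc n), bump (9 / 16) k x ≤ 1 := fun k x =>
    bump_le_one (by norm_num) x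
  have hW : ∫ x in ball (0 : Euc n) 1, (∫ s in (0 : ℝ)..u x, f s) * bump (9 / 16) 20 x ≤
      Cu * (8 * n + 48) := by
    refine le_trans ?_ (mul_le_mul_of_nonneg_left hc.integral_f_mul_bump_le hCu0.le)
    rw [← integral_const_mul]
    refine setIntegral_mono_on (integrableOn_mul_bump hFc (by norm_num))
      ((integrableOn_mul_bump hc.continuousOn_f (by norm_num)).const_mul _) measurableSet_ball
      fun x hx => ?_
    have h1 := hc.nl.primitive_le (hc.mem x hx)
    have h2 := hux x hx
    have h3 := hf0 x hx
    rw [show 20 = 16 + 4 by rfl, bump_add]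
    calc (∫ s in (0 : ℝ)..u x, f s) * (bump (9 / 16) 16 x * bump (9 / 16) 4 x)
        ≤ (u x * f (u x)) * (bump (9 / 16) 16 x * bump (9 / 16) 4 x) :=
          mul_le_mul_of_nonneg_right h1 (mul_nonneg (bump_nonneg x) (bump_nonneg x))
      _ = (u x * bump (9 / 16) 16 x) * (f (u x) * bump (9 / 16) 4 x) := by ring
      _ ≤ _ := mul_le_mul_of_nonneg_right h2 (mul_nonneg h3 (bump_nonneg x))
  have hκ1 := hc.nl.one_le
  have hfb := hc.continuousOn_rpow (b := b) (by linarith)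
  have hf := hc.continuousOn_f
  have iJ := integrableOn_mul_bump (k := 80) (hfb.mul (hf.pow 2)) (by norm_num)
  have iL := integrableOn_mul_bump (k := 64) ((hfb.mul (hf.pow 2)).mul hc.continuousOn_f')
    (by norm_num)
  simp only [Pi.pow_apply, Pi.mul_apply] at iJ iL
  have hG : ∫ x in ball (0 : Euc n) 1, (f (u x) ^ 2) ^ (b / 2 + 2) * bump (9 / 16) 120 x ≤
      (C₀ ^ 2 + 2 * M * κ) * C₃ + 2 * M * C₃ := by
    have h3 := add_le_add
      (mul_le_mul_of_nonneg_left hJ (show 0 ≤ C₀ ^ 2 + 2 * M * κ by positivity))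
      (mul_le_mul_of_nonneg_left hL (show 0 ≤ 2 * M by positivity))
    refine le_trans ?_ h3
    rw [← integral_const_mul, ← integral_const_mul,
      ← integral_add (iJ.const_mul _) (iL.const_mul _)]
    refine setIntegral_mono_on (integrableOn_mul_bump ((hf.pow 2).rpow_const
      fun _ _ => Or.inr (by linarith)) (by norm_num)) ((iJ.const_mul _).add (iL.const_mul _))
      measurableSet_ball fun x hx => ?_
    have hle := hc.nl.sq_le_add_mul (hc.mem x hx)
    have hmx := hmax x hx
    have h0 := h₀ m θ κ f f' f'' u u' u'' hc
    have h00 := hc.nl.nonneg 0 (left_mem_Icc.2 hc.nl.zero_le)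
    have hz : 0 ≤ bump (9 / 16) 1 x := bump_nonneg x
    have hz1 := hb1 1 x
    have hpow : (f (u x) ^ 2) ^ (b / 2 + 2) = f (u x) ^ b * f (u x) ^ 4 := by
      rw [← Real.rpow_natCast, ← Real.rpow_mul (hf0 x hx), ← Real.rpow_natCast,
        ← Real.rpow_add_of_nonneg (hf0 x hx) (by linarith) (by norm_num)]
      congr 1; push_cast; ring
    rw [hpow]
    have hP := Real.rpow_nonneg (hf0 x hx) b
    have hy' := hf0' x hx
    have hFx := hF0 x hx
    rw [bump_eq_pow] at hmx
    rw [bump_eq_pow (9 / 16) 120, bump_eq_pow (9 / 16) 80, bump_eq_pow (9 / 16) 64]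
    change _ ≤ M at hmx
    generalize bump (9 / 16) 1 x = z at *
    generalize (∫ s in (0 : ℝ)..u x, f s) = Fx at *
    generalize f (u x) ^ b = P at *
    generalize f (u x) = y at *
    generalize f' (u x) = y' at *
    have k1 : f 0 ^ 2 ≤ C₀ ^ 2 := pow_le_pow_left₀ h00 h0 2
    calc P * y ^ 4 * z ^ 120 = P * y ^ 2 * z ^ 80 * z ^ 40 * y ^ 2 := by ring
      _ ≤ P * y ^ 2 * z ^ 80 * z ^ 40 * (C₀ ^ 2 + 2 * Fx * (y' + κ)) := by
          gcongr; linarith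
      _ = P * y ^ 2 * z ^ 80 * (z ^ 40 * C₀ ^ 2) +
          P * y ^ 2 * (z ^ 64 * (z ^ 16 * y' + z ^ 16 * κ)) * (2 * (Fx * z ^ 40)) := by ring
      _ ≤ P * y ^ 2 * z ^ 80 * (1 * C₀ ^ 2) +
          P * y ^ 2 * (z ^ 64 * (1 * y' + z ^ 16 * κ)) * (2 * M) := by
          have : 0 ≤ κ := by linarith
          gcongr
          · exact pow_le_one₀ hz hz1
          · exact pow_le_one₀ hz hz1
      _ = _ := by ring
  have key := h₂ _ _ _ (fun x => f (u x) ^ 2) _ _ hreg hF0 (fun x _ => sq_nonneg _) (hf.pow 2)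
    (fun x hx => by
      have h1 := hc.eqn x hx
      have h2 : 0 ≤ f' (u x) * ∑ i, u' x (stdVec i) ^ 2 :=
        mul_nonneg (hf0' x hx) (Finset.sum_nonneg fun i _ => sq_nonneg _)
      have h3 : ∑ i, (f (u x) • u'' i x + u' x (stdVec i) • (f' (u x) • u' x)) (stdVec i) =
          f (u x) * ∑ i, u'' i x (stdVec i) + f' (u x) * ∑ i, u' x (stdVec i) ^ 2 := by
        simp only [add_apply, smul_apply, smul_eq_mul, Finset.mul_sum, ← Finset.sum_add_distrib]
        exact Finset.sum_congr rfl fun i _ => by ring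
      rw [h3, ← neg_eq_iff_eq_neg.2 (neg_eq_iff_eq_neg.1 h1)]
      nlinarith)
    (integrableOn_mul_bump hFc (by norm_num)) hW hG x₀ hx₀ Λ hΛ
  intro x hx
  have hx' := hmax x hx
  change M ≤ _ at key
  change _ ≤ M at hx'
  have e : C₂ * Λ * (2 * C₃ * (1 + κ ^ 2)) = 1 / 2 := by
    rw [hΛdef]; field_simp; norm_num
  have hκ2 : 2 * C₃ * (1 + κ) ≤ 2 * C₃ * (1 + κ ^ 2) := by
    gcongr
    nlinarith
  have h5 : C₂ * Λ * (2 * C₃ * (1 + κ)) * M ≤ 1 / 2 * M := by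
    rw [← e]; gcongr
  linarith

end IsNormalizedStable

lemma HasC2On.const_mul {n : ℕ} {U : Set (Euc n)} {b : Euc n → ℝ} {b' : Euc n → Euc n →L[ℝ] ℝ}
    {b'' : Fin n → Euc n → Euc n →L[ℝ] ℝ} (c : ℝ) (hb : HasC2On U b b' b'') :
    HasC2On U (fun x => c * b x) (fun x => c • b' x) (fun i x => c • b'' i x) :=
  ⟨hb.1.const_mul c, fun i => (hb.2 i).const_mul c⟩

/-- The nonlinearity satisfied by `u / L`. -/
lemma IsCRNonlinearity.of_scaled {θ K L M : ℝ} {f f' f'' : ℝ → ℝ} (hθ : 0 < θ) (hK : 0 ≤ K)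
    (hL : 0 < L) (hM0 : 0 ≤ M) (hM1 : M < 1) (hf : C2On01 f f' f'')
    (hf0 : ∀ t ∈ Ico (0 : ℝ) 1, 0 ≤ f t) (hf0' : ∀ t ∈ Ico (0 : ℝ) 1, 0 ≤ f' t)
    (hcr : ∀ t ∈ Ico (0 : ℝ) 1, (1 + θ) * f' t ^ 2 - K ≤ f'' t * f t) :
    IsCRNonlinearity (M / L) θ (K + 1) (fun t => L⁻¹ * f (L * t)) (fun t => f' (L * t))
      (fun t => L * f'' (L * t)) := by
  have hmaps : MapsTo (fun t => L * t) (Icc 0 (M / L)) (Ico 0 1) := fun t ht =>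
    ⟨mul_nonneg hL.le ht.1, lt_of_le_of_lt ((le_div_iff₀' hL).1 ht.2) hM1⟩
  have hlin : ∀ t ∈ Icc 0 (M / L), HasDerivWithinAt (fun t => L * t) L (Icc 0 (M / L)) t :=
    fun t _ => by simpa using (hasDerivWithinAt_id t (Icc 0 (M / L))).const_mul L
  refine ⟨by positivity, hθ, by linarith, fun t ht => ?_, fun t ht => ?_, ?_, fun t ht => ?_,
    fun t ht => hf0' _ (hmaps ht), fun t ht => ?_⟩
  · exact (((hf.1 _ (hmaps ht)).comp t (hlin t ht) hmaps).const_mul L⁻¹).congr_deriv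
      (by field_simp)
  · exact ((hf.2.1 _ (hmaps ht)).comp t (hlin t ht) hmaps).congr_deriv (mul_comm _ _)
  · exact continuousOn_const.mul (hf.2.2.comp (continuous_const_mul L).continuousOn hmaps)
  · exact mul_nonneg (by positivity) (hf0 _ (hmaps ht))
  · have h := hcr _ (hmaps ht)
    have e : L * f'' (L * t) * (L⁻¹ * f (L * t)) = f'' (L * t) * f (L * t) := by
      field_simp
    rw [e]
    nlinarith

/-- Interior estimate up to the optimal dimension 6: if `n ≤ 6` and `u` is a
nonnegative stable solution of `-Δu = f(u)` in `B₁ ⊂ ℝⁿ`, with `f ∈ C²([0,1))` nonnegative,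
nondecreasing, nonintegrable (`F(1) = +∞`) and satisfying `f''f ≥ (1+θ)f'² - K`, then
`F(u(x)) ≤ C ‖u‖²_{L¹(B₁)}` on `B_{1/2}`, with `C = C(n, θ, K)`. -/
theorem stmt0 (n : ℕ) (hn : 1 ≤ n) (hn6 : n ≤ 6) (θ K : ℝ) (hθ : 0 < θ) (hK : 0 ≤ K) :
    ∃ C : ℝ, 0 < C ∧
      ∀ (f f' f'' : ℝ → ℝ) (u : EuclideanSpace ℝ (Fin n) → ℝ),
        C2On01 f f' f'' →
        (∀ t ∈ Ico (0:ℝ) 1, 0 ≤ f t) →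
        (∀ t ∈ Ico (0:ℝ) 1, 0 ≤ f' t) →
        Tendsto (fun t => ∫ s in (0:ℝ)..t, f s) (𝓝[<] (1:ℝ)) atTop →
        (∀ t ∈ Ico (0:ℝ) 1, (1 + θ) * f' t ^ 2 - K ≤ f'' t * f t) →
        ContDiffOn ℝ 2 u (closure (ball (0:EuclideanSpace ℝ (Fin n)) 1)) →
        (∀ x ∈ closure (ball (0:EuclideanSpace ℝ (Fin n)) 1), 0 ≤ u x ∧ u x < 1) →
        (∀ x ∈ ball (0:EuclideanSpace ℝ (Fin n)) 1, -lap u x = f (u x)) →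
        StableSol f' u (ball 0 1) →
        ∀ x ∈ ball (0:EuclideanSpace ℝ (Fin n)) (1/2),
          (∫ s in (0:ℝ)..(u x), f s) ≤
            C * (∫ y in ball (0:EuclideanSpace ℝ (Fin n)) 1, u y) ^ 2 := by
  set t := min (θ / 2) (1 / 5) with ht
  have ht0 : 0 < t := by positivity
  have ht1 : t ≤ θ / 2 := min_le_left _ _
  have ht2 : t ≤ 1 / 5 := min_le_right _ _
  obtain ⟨C, hC, key⟩ := IsNormalizedStable.exists_primitive_mul_bump_le hn6 (b := 2 + t) (θ := θ)
    (κ := K + 1) (by linarith) (by linarith) (by nlinarith)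
  refine ⟨C / (5 / 16) ^ 40, by positivity, ?_⟩
  intro f f' f'' u hf hf0 hf0' _ hcr hu hu01 heq hst x hx
  obtain ⟨x₁, hx₁, hmax⟩ := (isBounded_ball.isCompact_closure :
    IsCompact (closure (ball (0 : Euc n) 1))).exists_isMaxOn
    ⟨0, subset_closure (mem_ball_self one_pos)⟩ hu.continuousOn
  have hbc : ball (0 : Euc n) 1 ⊆ closure (ball 0 1) := subset_closure
  have hxb : x ∈ ball (0 : Euc n) 1 := ball_subset_ball (by norm_num) hx
  have hInt : IntegrableOn u (ball 0 1) :=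
    (hu.continuousOn.integrableOn_compact isBounded_ball.isCompact_closure).mono_set hbc
  have hreg := (hu.mono hbc).hasC2On isOpen_ball
  set J := ∫ y in ball (0 : EuclideanSpace ℝ (Fin n)) 1, u y with hJ
  have hJ0 : 0 ≤ J := setIntegral_nonneg measurableSet_ball fun y hy => (hu01 y (hbc hy)).1
  have main : ∀ L, J < L → (∫ s in (0:ℝ)..(u x), f s) ≤ C / (5 / 16) ^ 40 * L ^ 2 := by
    intro L hJL
    have hL : 0 < L := by linarith
    have hLu : ∀ y, L * (L⁻¹ * u y) = u y := fun y => mul_inv_cancel_left₀ hL.ne' _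
    have hc : IsNormalizedStable (u x₁ / L) θ (K + 1) (fun t => L⁻¹ * f (L * t))
        (fun t => f' (L * t)) (fun t => L * f'' (L * t)) (fun y => L⁻¹ * u y) _ _ :=
      { nl := .of_scaled hθ hK hL (hu01 x₁ hx₁).1 (hu01 x₁ hx₁).2 hf hf0 hf0' hcr
        reg := hreg.const_mul L⁻¹
        mem := fun y hy => ⟨mul_nonneg (by positivity) (hu01 y (hbc hy)).1, by
          rw [div_eq_inv_mul]
          exact mul_le_mul_of_nonneg_left (hmax (hbc hy)) (by positivity)⟩
        eqn := fun y hy => by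
          simp only [smul_apply, smul_eq_mul, ← Finset.mul_sum, hLu, ← heq y hy, ← mul_neg]
          rfl
        stable := by simpa only [StableSol, hLu] using hst
        integrableOn := hInt.const_mul _
        integral_le := by
          rw [integral_const_mul, ← div_eq_inv_mul, div_le_one hL]
          exact hJL.le }
    have h := key _ _ _ _ _ _ _ hc x hxb
    have hsub : ∫ s in (0 : ℝ)..L⁻¹ * u x, L⁻¹ * f (L * s) =
        L⁻¹ * (L⁻¹ * ∫ s in (0 : ℝ)..u x, f s) := by
      rw [intervalIntegral.integral_const_mul, intervalIntegral.integral_comp_mul_left f hL.ne',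
        mul_zero, hLu, smul_eq_mul]
    have hF : 0 ≤ ∫ s in (0 : ℝ)..L⁻¹ * u x, L⁻¹ * f (L * s) :=
      hc.nl.primitive_nonneg (hc.mem x hxb)
    have hz : (5 / 16) ^ 40 ≤ bump (9 / 16) 40 x := by
      rw [bump_eq_pow]
      refine pow_le_pow_left₀ (by norm_num) ?_ 40
      have hx' : ‖x‖ < 1 / 2 := mem_ball_zero_iff.1 hx
      simp only [bump, pow_one]
      refine le_max_of_le_right ?_
      nlinarith [norm_nonneg x]
    have h2 := (mul_le_mul_of_nonneg_left hz hF).trans h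
    rw [hsub, ← le_div_iff₀ (by positivity), ← mul_assoc, ← sq, inv_pow,
      inv_mul_le_iff₀ (by positivity)] at h2
    linarith
  have hlim : Tendsto (fun L : ℝ => C / (5 / 16) ^ 40 * L ^ 2) (𝓝[>] J)
      (𝓝 (C / (5 / 16) ^ 40 * J ^ 2)) :=
    ((continuous_const.mul (continuous_pow 2)).tendsto J).mono_left nhdsWithin_le_nhds
  exact ge_of_tendsto hlim (eventually_mem_nhdsWithin.mono main)
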